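/- arXiv:math/0106135 — 15 statements merged into one kernel-verified Lean document; each statement's English description precedes it below -/
import Mathlib

section
/- For every n ≥ 1 and every p with 1 ≤ p ≤ n, the polynomial Σ_{i₁+⋯+i_p = n−p+2, i_j ≥ 0} x_{n−p+1}^{i_p} x_{n−p+2}^{i_{p−1}} ⋯ x_n^{i_1} — that is, the complete homogeneous symmetric polynomial h_{n−p+2} in the p variables x_{n−p+1}, …, x_n — belongs to the ideal I. -/
open MvPolynomial

/-- The complete homogeneous symmetric polynomial of degree `m` in the
variables `X i` for `i ∈ S`: the sum of all monomials of total degree `m`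
in those variables. -/
noncomputable def completeHomo (N : ℕ) (S : Finset (Fin N)) (m : ℕ) :
    MvPolynomial (Fin N) ℝ :=
  ∑ μ : Sym {i // i ∈ S} m, ((μ : Multiset {i // i ∈ S}).map
    (fun i => (X (i : Fin N) : MvPolynomial (Fin N) ℝ))).prod

/-- The ideal generated by the elementary symmetric polynomials
`e₁, …, e_{n+1}` in the variables `x₀, …, xₙ`. -/
noncomputable def symIdeal (n : ℕ) : Ideal (MvPolynomial (Fin (n + 1)) ℝ) :=
  Ideal.span ((fun j => MvPolynomial.esymm (Fin (n + 1)) ℝ j) '' Set.Icc 1 (n + 1))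

lemma coeff_prod_one_sub_aux (N : ℕ) (S : Finset (Fin N)) (k : ℕ) :
    PowerSeries.coeff k (∏ i ∈ S, (1 + PowerSeries.C (-(X i : MvPolynomial (Fin N) ℝ)) *
      PowerSeries.X)) = ∑ t ∈ S.powersetCard k, ∏ i ∈ t, (-(X i : MvPolynomial (Fin N) ℝ)) := by
  classical
  rw [Finset.prod_one_add, map_sum]
  have : ∀ t ∈ S.powerset, PowerSeries.coeff k (∏ i ∈ t,
      (PowerSeries.C (-(X i : MvPolynomial (Fin N) ℝ)) * PowerSeries.X)) =
      if t.card = k then ∏ i ∈ t, (-(X i : MvPolynomial (Fin N) ℝ)) else 0 := by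
    intro t _
    rw [Finset.prod_mul_distrib, ← map_prod, Finset.prod_const, PowerSeries.coeff_C_mul,
      PowerSeries.coeff_X_pow]
    simp only [eq_comm (a := k)]
    split_ifs <;> simp
  rw [Finset.sum_congr rfl this, ← Finset.sum_filter, Finset.powersetCard_eq_filter]

lemma geom_aux {R : Type*} [CommRing R] (a : R) :
    PowerSeries.mk (fun k => a ^ k) * (1 + PowerSeries.C (-a) * PowerSeries.X) = 1 := by
  ext k
  rw [mul_add, mul_one, ← mul_assoc, map_add]
  cases k with
  | zero => simp
  | succ k =>
    rw [PowerSeries.coeff_succ_mul_X, PowerSeries.coeff_mul_C]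
    simp [PowerSeries.coeff_one, pow_succ]

lemma completeHomo_coeff_aux (N : ℕ) (S : Finset (Fin N)) (m : ℕ) :
    completeHomo N S m = PowerSeries.coeff m
      (∏ i ∈ S, PowerSeries.mk (fun k => (X i : MvPolynomial (Fin N) ℝ) ^ k)) := by
  classical
  rw [← Finset.prod_coe_sort S (fun i => PowerSeries.mk (fun k =>
    (X i : MvPolynomial (Fin N) ℝ) ^ k)), PowerSeries.coeff_prod, completeHomo]
  refine Finset.sum_bij' (fun μ _ => Multiset.toFinsupp (μ : Multiset {i // i ∈ S}))
    (fun l hl => ⟨Finsupp.toMultiset l, ?_⟩) ?_ ?_ ?_ ?_ ?_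
  · rw [Finset.mem_finsuppAntidiag] at hl
    rw [Finsupp.card_toMultiset, ← hl.1, Finsupp.sum_fintype _ _ (fun _ => rfl)]
    rfl
  · intro μ _
    rw [Finset.mem_finsuppAntidiag]
    refine ⟨?_, Finset.subset_univ _⟩
    have := Multiset.toFinsupp_sum_eq (μ : Multiset {i // i ∈ S})
    rw [Finsupp.sum_fintype _ _ (fun _ => rfl)] at this
    exact this.trans μ.2
  · intros; exact Finset.mem_univ _
  · intro μ _
    apply Subtype.ext
    simp
  · intro l hl
    simp
  · intro μ _
    have hm : (do let a ← (μ : Multiset {i // i ∈ S}); pure (a : Fin N)) =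
        (μ : Multiset {i // i ∈ S}).map Subtype.val := by
      simp only [Multiset.bind_def, Multiset.pure_def, Multiset.bind_singleton]
    rw [hm, Multiset.map_map, Finset.prod_multiset_map_count]
    simp only [PowerSeries.coeff_mk, Multiset.toFinsupp_apply]
    refine Finset.prod_subset (Finset.subset_univ _) ?_
    intro i _ hi
    rw [Multiset.mem_toFinset] at hi
    rw [Multiset.count_eq_zero_of_notMem hi, pow_zero]

/-- For `1 ≤ p ≤ n`, the complete homogeneous symmetric polynomial
`h_{n-p+2}` in the `p` variables `x_{n-p+1}, …, x_n` lies in the ideal `I`. -/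
theorem relation_in_ideal (n : ℕ) (hn : 1 ≤ n) (p : ℕ) (hp1 : 1 ≤ p) (hpn : p ≤ n) :
    completeHomo (n + 1) (Finset.univ.filter (fun i => n - p + 1 ≤ (i : ℕ))) (n - p + 2) ∈
      symIdeal n := by
  classical
  set S : Finset (Fin (n + 1)) := Finset.univ.filter (fun i => n - p + 1 ≤ (i : ℕ)) with hS
  have hcard : Sᶜ.card < n - p + 2 := by
    have h1 : Sᶜ ⊆ (Finset.univ : Finset (Fin (n - p + 1))).image
        (fun i => (⟨i.1, by omega⟩ : Fin (n + 1))) := by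
      intro i hi
      simp only [hS, Finset.mem_compl, Finset.mem_filter, Finset.mem_univ, true_and,
        not_le] at hi
      exact Finset.mem_image.2 ⟨⟨i.1, hi⟩, Finset.mem_univ _, rfl⟩
    have h2 := (Finset.card_le_card h1).trans Finset.card_image_le
    rw [Finset.card_univ, Fintype.card_fin] at h2
    omega
  generalize n - p + 2 = m at *
  have key : (∏ i ∈ S, PowerSeries.mk (fun k => (X i : MvPolynomial (Fin (n + 1)) ℝ) ^ k)) *
      (∏ i, (1 + PowerSeries.C (-(X i : MvPolynomial (Fin (n + 1)) ℝ)) * PowerSeries.X)) =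
      ∏ i ∈ Sᶜ, (1 + PowerSeries.C (-(X i : MvPolynomial (Fin (n + 1)) ℝ)) *
        PowerSeries.X) := by
    rw [← Finset.prod_mul_prod_compl S (fun i => (1 + PowerSeries.C
      (-(X i : MvPolynomial (Fin (n + 1)) ℝ)) * PowerSeries.X)), ← mul_assoc,
      ← Finset.prod_mul_distrib, Finset.prod_congr rfl (fun i _ => geom_aux _),
      Finset.prod_const_one, one_mul]
  have hc := congrArg (PowerSeries.coeff m) key
  rw [coeff_prod_one_sub_aux, Finset.powersetCard_eq_empty.2 hcard, Finset.sum_empty,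
    PowerSeries.coeff_mul, ← Finset.add_sum_erase _ _
      (show (m, 0) ∈ Finset.HasAntidiagonal.antidiagonal m by simp)] at hc
  simp only [← completeHomo_coeff_aux, coeff_prod_one_sub_aux, Finset.powersetCard_zero,
    Finset.sum_singleton, Finset.prod_empty, mul_one] at hc
  rw [eq_neg_of_add_eq_zero_left hc]
  refine neg_mem (Ideal.sum_mem _ ?_)
  rintro ⟨a, b⟩ hab
  rw [Finset.mem_erase, Finset.HasAntidiagonal.mem_antidiagonal] at hab
  refine Ideal.mul_mem_left _ _ ?_
  have hb : b ≠ 0 := by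
    rintro rfl
    exact hab.1 (by simpa using hab.2)
  have he : (∑ t ∈ (Finset.univ : Finset (Fin (n + 1))).powersetCard b, ∏ i ∈ t,
      (-(X i : MvPolynomial (Fin (n + 1)) ℝ))) = (-1) ^ b * esymm (Fin (n + 1)) ℝ b := by
    rw [esymm, Finset.mul_sum]
    refine Finset.sum_congr rfl fun t ht => ?_
    rw [Finset.prod_neg, (Finset.mem_powersetCard.1 ht).2]
  by_cases hbn : b ≤ n + 1
  · change (∑ t ∈ (Finset.univ : Finset (Fin (n + 1))).powersetCard b, ∏ i ∈ t,
      (-(X i : MvPolynomial (Fin (n + 1)) ℝ))) ∈ _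
    rw [he]
    exact Ideal.mul_mem_left _ _ (Ideal.subset_span ⟨b, ⟨by omega, hbn⟩, rfl⟩)
  · rw [Finset.powersetCard_eq_empty.2 (by simp; omega), Finset.sum_empty]
    exact zero_mem _
end

section
/- For every n ≥ 1, the images under the quotient map ℝ[x₀,…,xₙ] → ℝ[x₀,…,xₙ]/I of the monomials x₁^{α₁} x₂^{α₂} ⋯ xₙ^{αₙ} with 0 ≤ αᵢ ≤ i for 1 ≤ i ≤ n (and x₀ occurring with exponent 0) form a basis of the quotient ring as a real vector space. -/
open MvPolynomial

namespace FlagAux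

open Polynomial in
theorem step {R : Type*} [CommRing R] [Nontrivial R] (m : ℕ) (p : R[X]) (hp : p.Monic)
    (hd : p.natDegree = m + 1) :
    Nontrivial (AdjoinRoot p) ∧
    (∃ q : (AdjoinRoot p)[X], q.Monic ∧ q.natDegree = m ∧
      p.map (algebraMap R (AdjoinRoot p)) = (Polynomial.X - Polynomial.C (AdjoinRoot.root p)) * q) ∧
    ∃ b : Module.Basis (Fin (m + 1)) R (AdjoinRoot p), ∀ k, b k = AdjoinRoot.root p ^ (k : ℕ) := by
  have hb : ∃ b : Module.Basis (Fin (m + 1)) R (AdjoinRoot p),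
      ∀ k, b k = AdjoinRoot.root p ^ (k : ℕ) := by
    refine ⟨(AdjoinRoot.powerBasis' hp).basis.reindex (finCongr hd), fun k => ?_⟩
    rw [Module.Basis.reindex_apply, PowerBasis.basis_eq_pow]
    rfl
  have hnt : Nontrivial (AdjoinRoot p) := by
    obtain ⟨b, -⟩ := hb
    exact ⟨b 0, 0, b.ne_zero 0⟩
  refine ⟨hnt, ⟨p.map (algebraMap R (AdjoinRoot p)) /ₘ (Polynomial.X - Polynomial.C (AdjoinRoot.root p)), ?_, ?_, ?_⟩, hb⟩
  · have h : (Polynomial.X - Polynomial.C (AdjoinRoot.root p)) *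
        (p.map (algebraMap R (AdjoinRoot p)) /ₘ (Polynomial.X - Polynomial.C (AdjoinRoot.root p))) =
        p.map (algebraMap R (AdjoinRoot p)) :=
      mul_divByMonic_eq_iff_isRoot.2 (AdjoinRoot.isRoot_root p)
    have h2 := hp.map (algebraMap R (AdjoinRoot p))
    rw [← h] at h2
    exact Polynomial.Monic.of_mul_monic_left (monic_X_sub_C _) h2
  · rw [natDegree_divByMonic _ (monic_X_sub_C _), hp.natDegree_map, hd, natDegree_X_sub_C]
    simp
  · exact (mul_divByMonic_eq_iff_isRoot.2 (AdjoinRoot.isRoot_root p)).symm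

/-- Existence of a splitting algebra in which the monomials are independent. -/
theorem indep (m : ℕ) : ∀ {R : Type} [CommRing R] [Nontrivial R] (p : Polynomial R)
    (_ : p.Monic) (_ : p.natDegree = m),
    ∃ (S : Type) (_ : CommRing S) (_ : Algebra R S) (s : Fin m → S),
      p.map (algebraMap R S) = ∏ i, (Polynomial.X - Polynomial.C (s i)) ∧
      LinearIndependent R (fun α : (∀ i : Fin m, Fin (i.val + 1)) => ∏ i, s i ^ (α i : ℕ)) := by
  induction m with
  | zero =>
    intro R _ _ p hp hd
    refine ⟨R, inferInstance, inferInstance, Fin.elim0, ?_, ?_⟩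
    · simp [Polynomial.eq_one_of_monic_natDegree_zero hp hd]
    · have h := (Module.Basis.singleton (∀ i : Fin 0, Fin (i.val + 1)) R).linearIndependent
      convert h using 1
      all_goals first | rfl | (funext α; simp)
  | succ m ih =>
    intro R _ _ p hp hd
    obtain ⟨hnt, ⟨q, hq, hqd, hpq⟩, b, hb⟩ := step m p hp hd
    obtain ⟨S, _, algS, s, hs, hli⟩ := ih q hq hqd
    let : Algebra R S := ((algebraMap (AdjoinRoot p) S).comp (algebraMap R (AdjoinRoot p))).toAlgebra
    have : IsScalarTower R (AdjoinRoot p) S := IsScalarTower.of_algebraMap_eq fun _ => rfl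
    refine ⟨S, inferInstance, inferInstance,
      Fin.snoc s (algebraMap (AdjoinRoot p) S (AdjoinRoot.root p)), ?_, ?_⟩
    · rw [IsScalarTower.algebraMap_eq R (AdjoinRoot p) S, ← Polynomial.map_map, hpq,
        Polynomial.map_mul, hs, Fin.prod_univ_castSucc, mul_comm]
      simp
    · have h := linearIndependent_smul b.linearIndependent hli
      have h2 := h.comp (fun α : (∀ i : Fin (m + 1), Fin (i.val + 1)) =>
        ((α (Fin.last m), fun i => α i.castSucc) : Fin (m + 1) × (∀ i : Fin m, Fin (i.val + 1)))) ?_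
      · convert h2 using 1
        funext α
        simp [Fin.prod_univ_castSucc, hb, Algebra.smul_def, mul_comm]
      · intro α β h
        rw [Prod.mk.injEq] at h
        funext i
        refine Fin.lastCases h.1 (fun j => congrFun h.2 j) i

theorem spanning (m : ℕ) : ∀ {R : Type} [CommRing R] [Nontrivial R] (p : Polynomial R)
    (_ : p.Monic) (_ : p.natDegree = m)
    (S : Type) [CommRing S] [Algebra R S] (s : Fin m → S)
    (_ : p.map (algebraMap R S) = ∏ i, (Polynomial.X - Polynomial.C (s i)))
    (_ : Algebra.adjoin R (Set.range s) = ⊤),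
      Submodule.span R (Set.range
        (fun α : (∀ i : Fin m, Fin (i.val + 1)) => ∏ i, s i ^ (α i : ℕ))) = ⊤ := by
  induction m with
  | zero =>
    intro R _ _ p hp hd S _ _ s hs hadj
    have : Set.range s = ∅ := Set.range_eq_empty s
    rw [this, Algebra.adjoin_empty] at hadj
    have h := congrArg Subalgebra.toSubmodule hadj
    rw [Algebra.toSubmodule_bot, Algebra.top_toSubmodule] at h
    rw [← h, Submodule.one_eq_span]
    simp
  | succ m ih =>
    intro R _ _ p hp hd S _ _ s hs hadj
    obtain ⟨hnt, ⟨q, hq, hqd, hpq⟩, b, hb⟩ := step m p hp hd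
    have hroot : p.eval₂ (algebraMap R S) (s (Fin.last m)) = 0 := by
      rw [← Polynomial.eval_map, hs, Fin.prod_univ_castSucc]
      simp
    let : Algebra (AdjoinRoot p) S := (AdjoinRoot.lift (algebraMap R S) _ hroot).toAlgebra
    have : IsScalarTower R (AdjoinRoot p) S := IsScalarTower.of_algebraMap_eq fun r =>
      (AdjoinRoot.lift_of hroot).symm
    have hr : algebraMap (AdjoinRoot p) S (AdjoinRoot.root p) = s (Fin.last m) :=
      AdjoinRoot.lift_root hroot
    have key := ih q hq hqd S (fun i => s i.castSucc) ?_ ?_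
    · have h2 := Submodule.span_smul_of_span_eq_top b.span_eq
        (Set.range (fun α : (∀ i : Fin m, Fin (i.val + 1)) => ∏ i, s i.castSucc ^ (α i : ℕ)))
      rw [key, Submodule.restrictScalars_top] at h2
      rw [eq_top_iff, ← h2, Submodule.span_le]
      rintro _ ⟨_, ⟨k, rfl⟩, _, ⟨α, rfl⟩, rfl⟩
      apply Submodule.subset_span
      refine ⟨Fin.snoc (α := fun i : Fin (m + 1) => Fin (i.val + 1)) α k, ?_⟩
      simp [Fin.prod_univ_castSucc, hb, Algebra.smul_def, mul_comm, hr]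
    · rw [IsScalarTower.algebraMap_eq R (AdjoinRoot p) S, ← Polynomial.map_map, hpq,
        Polynomial.map_mul, Fin.prod_univ_castSucc, mul_comm] at hs
      simp only [Polynomial.map_sub, Polynomial.map_X, Polynomial.map_C, hr] at hs
      exact (Polynomial.monic_X_sub_C (s (Fin.last m))).isRegular.right hs
    · rw [eq_top_iff]
      intro x _
      have hx : x ∈ Algebra.adjoin R (Set.range s) := by rw [hadj]; trivial
      have hle : Algebra.adjoin R (Set.range s) ≤ (Algebra.adjoin (AdjoinRoot p)
          (Set.range fun i : Fin m => s i.castSucc)).restrictScalars R := by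
        apply Algebra.adjoin_le
        rintro _ ⟨i, rfl⟩
        refine Fin.lastCases ?_ (fun j => ?_) i
        · rw [← hr, SetLike.mem_coe, Subalgebra.mem_restrictScalars]
          exact Subalgebra.algebraMap_mem (Algebra.adjoin (AdjoinRoot p)
            (Set.range fun i : Fin m => s i.castSucc)) _
        · rw [SetLike.mem_coe, Subalgebra.mem_restrictScalars]
          exact Algebra.subset_adjoin ⟨j, rfl⟩
      exact hle hx

theorem vieta {S : Type} [CommRing S] (m : ℕ) (s : Fin m → S) :
    ((Polynomial.X : Polynomial S) ^ m = ∏ i, (Polynomial.X - Polynomial.C (s i))) ↔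
    ∀ j ∈ Set.Icc 1 m, ((Finset.univ : Finset (Fin m)).val.map s).esymm j = 0 := by
  have hprod : ∏ i, (Polynomial.X - Polynomial.C (s i)) =
      (((Finset.univ : Finset (Fin m)).val.map s).map
        fun t => Polynomial.X - Polynomial.C t).prod := by
    rw [Multiset.map_map]; rfl
  have hcard : Multiset.card ((Finset.univ : Finset (Fin m)).val.map s) = m := by simp
  rw [hprod]
  constructor
  · rintro h j ⟨h1, h2⟩
    have h3 := Multiset.prod_X_sub_C_coeff ((Finset.univ : Finset (Fin m)).val.map s)
      (k := m - j) (by rw [hcard]; omega)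
    rw [← h, hcard, Polynomial.coeff_X_pow, if_neg (by omega),
      show m - (m - j) = j by omega] at h3
    have h4 : ((-1 : S) ^ j) * (-1) ^ j = 1 := by rw [← mul_pow]; simp
    calc _ = ((-1 : S) ^ j * (-1) ^ j) * ((Finset.univ : Finset (Fin m)).val.map s).esymm j := by
            rw [h4, one_mul]
      _ = 0 := by rw [mul_assoc, ← h3, mul_zero]
  · intro h
    rw [Multiset.prod_X_sub_X_eq_sum_esymm, hcard, Finset.sum_eq_single 0]
    · simp [Multiset.esymm]
    · intro j hj hj0
      rw [h j ⟨by omega, by simp at hj; omega⟩]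
      simp
    · simp

end FlagAux

/-- The images in the quotient `ℝ[x₀,…,xₙ]/I` of the monomials
`x₁^{α₁} ⋯ xₙ^{αₙ}` with `0 ≤ αᵢ ≤ i` (and `x₀` not occurring) form a basis
of the quotient as a real vector space.  Here `x_i` for `1 ≤ i ≤ n` is the
variable `X i.succ` for `i : Fin n`, and the exponent of `x_i` ranges over
`0, …, i`, i.e. over `Fin (i.val + 2)`. -/
theorem basis_of_flag_quotient (n : ℕ) (hn : 1 ≤ n) :
    LinearIndependent ℝ
      (fun α : (∀ i : Fin n, Fin (i.val + 2)) =>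
        Ideal.Quotient.mk (symIdeal n)
          (∏ i : Fin n, (X i.succ : MvPolynomial (Fin (n + 1)) ℝ) ^ (α i : ℕ))) ∧
    Submodule.span ℝ
      (Set.range (fun α : (∀ i : Fin n, Fin (i.val + 2)) =>
        Ideal.Quotient.mk (symIdeal n)
          (∏ i : Fin n, (X i.succ : MvPolynomial (Fin (n + 1)) ℝ) ^ (α i : ℕ)))) = ⊤ := by
  have hmono : ∀ {S : Type} [CommRing S] (s : Fin (n + 1) → S)
      (β : ∀ i : Fin (n + 1), Fin (i.val + 1)),
      ∏ i, s i ^ (β i : ℕ) = ∏ i : Fin n, s i.succ ^ (β i.succ : ℕ) := by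
    intro S _ s β
    rw [Fin.prod_univ_succ]
    have : (β 0 : ℕ) = 0 := by
      have := (β 0).isLt
      simp only [Fin.val_zero] at this
      omega
    rw [this, pow_zero, one_mul]
  constructor
  · obtain ⟨S, _, _, s, hs, hli⟩ := FlagAux.indep (n + 1)
      ((Polynomial.X : Polynomial ℝ) ^ (n + 1)) (Polynomial.monic_X_pow _)
      (Polynomial.natDegree_X_pow _)
    rw [Polynomial.map_pow, Polynomial.map_X, FlagAux.vieta] at hs
    have hker : ∀ a ∈ symIdeal n, aeval (R := ℝ) s a = 0 := by
      intro a ha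
      have hle : symIdeal n ≤ RingHom.ker (aeval (R := ℝ) s) := by
        refine Ideal.span_le.2 ?_
        rintro _ ⟨j, hj, rfl⟩
        change aeval (R := ℝ) s _ = 0
        rw [aeval_esymm_eq_multiset_esymm]
        exact hs j hj
      exact hle ha
    refine LinearIndependent.of_comp (Ideal.Quotient.liftₐ (symIdeal n) (aeval (R := ℝ) s)
      hker).toLinearMap ?_
    have h2 := hli.comp (fun α : (∀ i : Fin n, Fin (i.val + 2)) =>
      (Fin.cons (α := fun i : Fin (n + 1) => Fin (i.val + 1)) 0 α)) ?_
    · have heq : ((Ideal.Quotient.liftₐ (symIdeal n) (aeval (R := ℝ) s) hker).toLinearMap ∘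
          fun α : (∀ i : Fin n, Fin (i.val + 2)) => (Ideal.Quotient.mk (symIdeal n))
            (∏ i : Fin n, (X i.succ : MvPolynomial (Fin (n + 1)) ℝ) ^ (α i : ℕ))) =
          fun α => ∏ i : Fin n, s i.succ ^ (α i : ℕ) := by
        funext α
        change aeval (R := ℝ) s _ = _
        rw [map_prod]
        simp only [map_pow, aeval_X]
      rw [heq]
      have heq2 : ((fun β : (∀ i : Fin (n + 1), Fin (i.val + 1)) => ∏ i, s i ^ (β i : ℕ)) ∘
          fun α : (∀ i : Fin n, Fin (i.val + 2)) =>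
            (Fin.cons (α := fun i : Fin (n + 1) => Fin (i.val + 1)) 0 α)) =
          fun α => ∏ i : Fin n, s i.succ ^ (α i : ℕ) := by
        funext α
        simp only [Function.comp_apply, hmono, Fin.cons_succ]
      rw [heq2] at h2
      exact h2
    · intro α β h
      exact (Fin.cons_injective2 h).2
  · have h := FlagAux.spanning (n + 1)
      ((Polynomial.X : Polynomial ℝ) ^ (n + 1)) (Polynomial.monic_X_pow _)
      (Polynomial.natDegree_X_pow _) (MvPolynomial (Fin (n + 1)) ℝ ⧸ symIdeal n)
      (fun i => Ideal.Quotient.mkₐ ℝ (symIdeal n) (X i)) ?_ ?_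
    · rw [eq_top_iff, ← h]
      apply Submodule.span_mono
      rintro _ ⟨β, rfl⟩
      refine ⟨fun i => β i.succ, ?_⟩
      simp only [hmono]
      simp
    · rw [Polynomial.map_pow, Polynomial.map_X, FlagAux.vieta]
      intro j hj
      rw [← aeval_esymm_eq_multiset_esymm (Fin (n + 1)) ℝ]
      have : aeval (R := ℝ) (fun i => Ideal.Quotient.mkₐ ℝ (symIdeal n) (X i)) =
          Ideal.Quotient.mkₐ ℝ (symIdeal n) := by
        ext i; simp
      rw [this]
      exact Ideal.Quotient.eq_zero_iff_mem.2 (Ideal.subset_span ⟨j, hj, rfl⟩)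
    · have : Set.range (fun i => Ideal.Quotient.mkₐ ℝ (symIdeal n) (X i)) =
          Ideal.Quotient.mkₐ ℝ (symIdeal n) '' (Set.range X) := by
        rw [← Set.range_comp]; rfl
      rw [this, ← AlgHom.map_adjoin, MvPolynomial.adjoin_range_X, Algebra.map_top,
        AlgHom.range_eq_top]
      exact Ideal.Quotient.mkₐ_surjective _ _
end

section
/- For every n ≥ 1, every k with 2 ≤ k ≤ n+1, and every integer m ≥ k, the complete homogeneous symmetric polynomial h_m in the variables x_{k−1}, x_k, …, x_n belongs to the ideal I. -/
open MvPolynomial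

theorem aux_sym_sum {σ A : Type*} [Fintype σ] [DecidableEq σ] [CommRing A] (f : σ → A) (m : ℕ) :
    ∑ μ : Sym σ m, ((μ : Multiset σ).map f).prod
      = PowerSeries.coeff m (∏ i, PowerSeries.mk (fun j => f i ^ j)) := by
  rw [PowerSeries.coeff_prod]
  refine Finset.sum_bij (fun μ _ => Multiset.toFinsupp (μ : Multiset σ)) ?_ ?_ ?_ ?_
  · intro μ _
    rw [Finset.mem_finsuppAntidiag]
    refine ⟨?_, Finset.subset_univ _⟩
    have h := Multiset.toFinsupp_sum_eq (μ : Multiset σ)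
    rw [Finsupp.sum_fintype _ _ (fun _ => rfl)] at h
    exact h.trans μ.2
  · intro a _ b _ h
    exact Subtype.ext (Multiset.toFinsupp.injective h)
  · intro b hb
    rw [Finset.mem_finsuppAntidiag] at hb
    refine ⟨⟨Finsupp.toMultiset b, ?_⟩, Finset.mem_univ _, ?_⟩
    · rw [Finsupp.card_toMultiset, Finsupp.sum_fintype _ _ (fun _ => rfl)]
      exact hb.1
    · exact Finsupp.toMultiset_toFinsupp b
  · intro μ _
    rw [Finset.prod_multiset_map_count]
    simp only [PowerSeries.coeff_mk, Multiset.toFinsupp_apply]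
    refine Finset.prod_subset (Finset.subset_univ _) ?_
    intro x _ hx
    rw [Multiset.mem_toFinset] at hx
    rw [Multiset.count_eq_zero_of_notMem hx, pow_zero]

theorem aux_geom {A : Type*} [CommRing A] (q : A) :
    PowerSeries.mk (fun j => q ^ j) * (1 + PowerSeries.X * PowerSeries.C (-q)) = 1 := by
  ext j
  rw [mul_add, mul_one, ← mul_assoc]
  cases j with
  | zero => simp
  | succ j =>
    simp [PowerSeries.coeff_succ_mul_X, PowerSeries.coeff_one, pow_succ]

theorem aux_coeff {ι A : Type*} [CommRing A] (f : ι → A) (T : Finset ι) (m : ℕ)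
    (hm : T.card < m) :
    PowerSeries.coeff m (∏ i ∈ T, (1 + PowerSeries.X * PowerSeries.C (f i))) = 0 := by
  rw [Finset.prod_one_add, map_sum]
  refine Finset.sum_eq_zero fun t ht => ?_
  have := Finset.card_le_card (Finset.mem_powerset.1 ht)
  rw [Finset.prod_mul_distrib, Finset.prod_const, ← map_prod, PowerSeries.coeff_mul_C,
    PowerSeries.coeff_X_pow, if_neg (by omega), zero_mul]

theorem aux_full (n : ℕ) :
    ∏ i : Fin (n + 1), (1 + PowerSeries.X * PowerSeries.C
      (-(Ideal.Quotient.mk (symIdeal n) (X i)))) = 1 := by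
  rw [Finset.prod_one_add, Finset.sum_powerset, Finset.sum_range_succ']
  have h : ∀ j ∈ Finset.range (Finset.univ : Finset (Fin (n + 1))).card,
      ∑ t ∈ Finset.powersetCard (j + 1) (Finset.univ : Finset (Fin (n + 1))),
        ∏ i ∈ t, (PowerSeries.X * PowerSeries.C
          (-(Ideal.Quotient.mk (symIdeal n) (X i)))) = 0 := by
    intro j hj
    have hj' : j < n + 1 := by simpa using hj
    have he : Ideal.Quotient.mk (symIdeal n) (esymm (Fin (n + 1)) ℝ (j + 1)) = 0 := by
      rw [Ideal.Quotient.eq_zero_iff_mem]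
      exact Ideal.subset_span ⟨j + 1, ⟨by omega, by omega⟩, rfl⟩
    have : ∀ t ∈ Finset.powersetCard (j + 1) (Finset.univ : Finset (Fin (n + 1))),
        ∏ i ∈ t, (PowerSeries.X * PowerSeries.C
          (-(Ideal.Quotient.mk (symIdeal n) (X i)))) =
        (-PowerSeries.X) ^ (j + 1) * PowerSeries.C (Ideal.Quotient.mk (symIdeal n)
          (∏ i ∈ t, X i)) := by
      intro t ht
      rw [← (Finset.mem_powersetCard.1 ht).2, map_prod, map_prod, ← Finset.prod_const,
        ← Finset.prod_mul_distrib]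
      refine Finset.prod_congr rfl fun i _ => ?_
      rw [map_neg]; ring
    rw [Finset.sum_congr rfl this, ← Finset.mul_sum, ← map_sum, ← map_sum]
    change _ * PowerSeries.C (Ideal.Quotient.mk (symIdeal n) (esymm (Fin (n + 1)) ℝ (j + 1))) = 0
    rw [he, map_zero, mul_zero]
  rw [Finset.sum_eq_zero h]
  simp

/-- For `2 ≤ k ≤ n+1` and every `m ≥ k`, the complete homogeneous symmetric
polynomial `h_m` in the variables `x_{k-1}, x_k, …, x_n` lies in the ideal `I`. -/
theorem completeHomo_tail_in_ideal (n : ℕ) (hn : 1 ≤ n) (k : ℕ) (hk2 : 2 ≤ k)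
    (hkn : k ≤ n + 1) (m : ℕ) (hm : k ≤ m) :
    completeHomo (n + 1) (Finset.univ.filter (fun i => k - 1 ≤ (i : ℕ))) m ∈
      symIdeal n := by
  rw [← Ideal.Quotient.eq_zero_iff_mem]
  set S : Finset (Fin (n + 1)) := Finset.univ.filter (fun i => k - 1 ≤ (i : ℕ)) with hS
  set q := Ideal.Quotient.mk (symIdeal n) with hq
  have h1 : q (completeHomo (n + 1) S m) =
      PowerSeries.coeff m (∏ i ∈ S, PowerSeries.mk (fun j => q (X i) ^ j)) := by
    rw [← Finset.prod_coe_sort S (fun i => PowerSeries.mk (fun j => q (X i) ^ j)),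
      ← aux_sym_sum (fun i : {i // i ∈ S} => q (X (i : Fin (n + 1)))) m]
    simp only [completeHomo, map_sum, map_multiset_prod, Multiset.map_map, Function.comp_def]
    refine Finset.sum_congr rfl fun μ _ => ?_
    simp only [Multiset.bind_def, Multiset.pure_def, Multiset.bind_singleton, Multiset.map_map,
      Function.comp_def]
  have h2 : (∏ i ∈ S, PowerSeries.mk (fun j => q (X i) ^ j)) =
      ∏ i ∈ Sᶜ, (1 + PowerSeries.X * PowerSeries.C (-(q (X i)))) := by
    have h3 := aux_full n
    rw [← Finset.prod_mul_prod_compl S] at h3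
    have h4 : (∏ i ∈ S, PowerSeries.mk (fun j => q (X i) ^ j)) *
        ∏ i ∈ S, (1 + PowerSeries.X * PowerSeries.C (-(q (X i)))) = 1 := by
      rw [← Finset.prod_mul_distrib]
      exact Finset.prod_eq_one (fun i _ => aux_geom (q (X i)))
    exact left_inv_eq_right_inv h4 h3
  rw [h1, h2]
  apply aux_coeff
  have hc : Sᶜ.card ≤ (Finset.range (k - 1)).card := by
    refine Finset.card_le_card_of_injOn (fun i : Fin (n + 1) => (i : ℕ)) ?_
      (fun a _ b _ h => Fin.ext h)
    intro i hi
    simp [hS] at hi ⊢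
    omega
  rw [Finset.card_range] at hc
  omega
end

section
/- For every n ≥ 1, the quotient ring ℝ[x₀,…,xₙ]/I is a finite-dimensional real vector space of dimension (n+1)!. -/
open MvPolynomial

theorem split_alg_exists (m : ℕ) : ∀ (R : Type) [CommRing R] [Nontrivial R] (f : Polynomial R),
    f.Monic → f.natDegree = m →
    ∃ (S : Type) (_ : CommRing S) (_ : Algebra R S) (x : Fin m → S),
      Module.Free R S ∧ Module.Finite R S ∧ Module.finrank R S = m.factorial ∧
      f.map (algebraMap R S) = ∏ i, (Polynomial.X - Polynomial.C (x i)) ∧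
      (∀ (T : Type) [CommRing T] (h : R →+* T) (y : Fin m → T),
        f.map h = ∏ i, (Polynomial.X - Polynomial.C (y i)) →
        ∃ φ : S →+* T, φ.comp (algebraMap R S) = h ∧ ∀ i, φ (x i) = y i) ∧
      (∀ (T : Type) [CommRing T] (φ ψ : S →+* T),
        φ.comp (algebraMap R S) = ψ.comp (algebraMap R S) →
        (∀ i, φ (x i) = ψ (x i)) → φ = ψ) := by
  induction m with
  | zero =>
    intro R _ _ f hf hd
    have hf1 : f = 1 := hf.natDegree_eq_zero.mp hd
    subst hf1
    refine ⟨R, inferInstance, Algebra.id R, Fin.elim0, inferInstance, inferInstance, ?_, ?_, ?_, ?_⟩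
    · simp
    · simp
    · intro T _ h y _
      exact ⟨h, by ext; simp, fun i => i.elim0⟩
    · intro T _ φ ψ h _
      simpa using h
  | succ m ih =>
    intro R _ _ f hf hd
    have hfree := hf.free_adjoinRoot
    have hfin := hf.finite_adjoinRoot
    have hrank : Module.finrank R (AdjoinRoot f) = m + 1 := by
      rw [PowerBasis.finrank (AdjoinRoot.powerBasis' hf), AdjoinRoot.powerBasis'_dim, hd]
    have hnt : Nontrivial (AdjoinRoot f) :=
      Module.nontrivial_of_finrank_pos (R := R) (by omega)
    let g : Polynomial (AdjoinRoot f) :=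
      f.map (AdjoinRoot.of f) /ₘ (Polynomial.X - Polynomial.C (AdjoinRoot.root f))
    have hg : (Polynomial.X - Polynomial.C (AdjoinRoot.root f)) * g = f.map (AdjoinRoot.of f) :=
      Polynomial.mul_divByMonic_eq_iff_isRoot.mpr (AdjoinRoot.isRoot_root f)
    have hgm : g.Monic := by
      have h1 := hf.map (AdjoinRoot.of f)
      rw [← hg] at h1
      exact (Polynomial.monic_X_sub_C _).of_mul_monic_left h1
    have hgd : g.natDegree = m := by
      simp only [g]
      rw [Polynomial.natDegree_divByMonic _ (Polynomial.monic_X_sub_C _), hf.natDegree_map, hd]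
      simp
    obtain ⟨S, _, _, x, hSf, hSfin, hSr, hSs, hSe, hSu⟩ := ih (AdjoinRoot f) g hgm hgd
    letI : Algebra R S := ((algebraMap (AdjoinRoot f) S).comp (AdjoinRoot.of f)).toAlgebra
    have hmap : algebraMap R S = (algebraMap (AdjoinRoot f) S).comp (AdjoinRoot.of f) := rfl
    haveI : IsScalarTower R (AdjoinRoot f) S := IsScalarTower.of_algebraMap_eq (fun _ => rfl)
    refine ⟨S, inferInstance, inferInstance,
      Fin.cons (algebraMap (AdjoinRoot f) S (AdjoinRoot.root f)) x,
      Module.Free.trans (R := R) (S := AdjoinRoot f) (M := S), 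
      Module.Finite.trans (AdjoinRoot f) S, ?_, ?_, ?_, ?_⟩
    · rw [← Module.finrank_mul_finrank R (AdjoinRoot f) S, hrank, hSr, Nat.factorial_succ]
    · rw [hmap, ← Polynomial.map_map, ← hg, Polynomial.map_mul, hSs, Fin.prod_univ_succ]
      simp
    · intro T _ h y hy
      have hroot : f.eval₂ h (y 0) = 0 := by
        rw [← Polynomial.eval_map, hy, Fin.prod_univ_succ]
        simp
      have hy2 : g.map (AdjoinRoot.lift h (y 0) hroot) =
          ∏ i : Fin m, (Polynomial.X - Polynomial.C (y i.succ)) := by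
        apply (Polynomial.monic_X_sub_C (y 0)).isRegular.left
        have h2 := congrArg (Polynomial.map (AdjoinRoot.lift h (y 0) hroot)) hg
        rw [Polynomial.map_map, AdjoinRoot.lift_comp_of, hy, Fin.prod_univ_succ] at h2
        simpa using h2
      obtain ⟨φ, h1, h2⟩ := hSe T _ _ hy2
      refine ⟨φ, ?_, ?_⟩
      · rw [hmap, ← RingHom.comp_assoc, h1, AdjoinRoot.lift_comp_of]
      · intro i
        refine Fin.cases ?_ (fun i => ?_) i
        · have := congrArg (fun k => k (AdjoinRoot.root f)) h1
          simpa using this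
        · simpa using h2 i
    · intro T _ φ ψ h1 h2
      apply hSu T φ ψ
      · apply AdjoinRoot.ringHom_ext
        · rw [RingHom.comp_assoc, RingHom.comp_assoc]; exact h1
        · simpa using h2 0
      · intro i
        simpa using h2 i.succ

theorem prod_eq_X_pow_iff {m : ℕ} {S : Type} [CommRing S] [Algebra ℝ S] (y : Fin m → S) :
    (∏ i, (Polynomial.X - Polynomial.C (y i))) = Polynomial.X ^ m ↔
      ∀ j ∈ Set.Icc 1 m, aeval y (esymm (Fin m) ℝ j) = 0 := by
  have hc : Multiset.card (Finset.univ.val.map y) = m := by simp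
  have hp : (∏ i, (Polynomial.X - Polynomial.C (y i))) =
      ((Finset.univ.val.map y).map fun t => Polynomial.X - Polynomial.C t).prod := by
    rw [Multiset.map_map]; rfl
  simp only [aeval_esymm_eq_multiset_esymm]
  constructor
  · rintro h j ⟨h1, h2⟩
    have h3 := Multiset.prod_X_sub_C_coeff (Finset.univ.val.map y) (k := m - j) (by omega)
    rw [← hp, h, hc, Polynomial.coeff_X_pow, if_neg (by omega), show m - (m - j) = j by omega] at h3
    have h4 := congrArg (fun z => (-1) ^ j * z) h3.symm
    simpa [← mul_assoc, ← mul_pow] using h4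
  · intro h
    rw [hp, Multiset.prod_X_sub_X_eq_sum_esymm, hc, Finset.sum_eq_single 0]
    · simp [Multiset.esymm]
    · intro j hj hj0
      rw [h j ⟨by omega, by simp at hj; omega⟩]
      simp
    · simp

/-- The quotient `ℝ[x₀,…,xₙ]/I` is a finite-dimensional real vector space
of dimension `(n+1)!`. -/
theorem finrank_flag_quotient (n : ℕ) (hn : 1 ≤ n) :
    Module.Finite ℝ (MvPolynomial (Fin (n + 1)) ℝ ⧸ symIdeal n) ∧
    Module.finrank ℝ (MvPolynomial (Fin (n + 1)) ℝ ⧸ symIdeal n) =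
      Nat.factorial (n + 1) := by
  obtain ⟨S, _, _, x, _, hSfin, hSr, hSs, hSe, hSu⟩ :=
    split_alg_exists (n + 1) ℝ (Polynomial.X ^ (n + 1)) (Polynomial.monic_X_pow _) (by simp)
  have hx := (prod_eq_X_pow_iff x).mp (by rw [← hSs]; simp)
  let y : Fin (n + 1) → MvPolynomial (Fin (n + 1)) ℝ ⧸ symIdeal n :=
    fun i => Ideal.Quotient.mkₐ ℝ (symIdeal n) (X i)
  have hya : aeval y = Ideal.Quotient.mkₐ ℝ (symIdeal n) := by
    ext i; simp [y]
  have hy := (prod_eq_X_pow_iff y).mpr (by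
    intro j hj
    rw [hya]
    exact Ideal.Quotient.eq_zero_iff_mem.mpr (Ideal.subset_span ⟨j, hj, rfl⟩))
  obtain ⟨φ, h1, h2⟩ := hSe _ (algebraMap ℝ _) y (by rw [hy]; simp)
  let φa : S →ₐ[ℝ] (MvPolynomial (Fin (n + 1)) ℝ ⧸ symIdeal n) :=
    { φ with commutes' := fun r => congrArg (fun k => k r) h1 }
  have hφa : ∀ s, φa s = φ s := fun _ => rfl
  have hker : ∀ a ∈ symIdeal n, aeval (R := ℝ) x a = 0 := by
    intro a ha
    have hle : symIdeal n ≤ RingHom.ker (aeval (R := ℝ) x) := by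
      refine Ideal.span_le.mpr ?_
      rintro _ ⟨j, hj, rfl⟩
      exact hx j hj
    exact hle ha
  let ψ : (MvPolynomial (Fin (n + 1)) ℝ ⧸ symIdeal n) →ₐ[ℝ] S :=
    Ideal.Quotient.liftₐ (symIdeal n) (aeval x) hker
  have hψ : ∀ i, ψ (y i) = x i := by
    intro i
    change aeval x (X i : MvPolynomial (Fin (n + 1)) ℝ) = x i
    simp
  let e : S ≃ₐ[ℝ] (MvPolynomial (Fin (n + 1)) ℝ ⧸ symIdeal n) :=
    AlgEquiv.ofAlgHom φa ψ
      (by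
        apply Ideal.Quotient.algHom_ext
        ext i
        change φa (ψ (y i)) = y i
        rw [hψ, hφa, h2])
      (by
        apply AlgHom.coe_ringHom_injective
        apply hSu
        · ext r
          simp
        · intro i
          change ψ (φ (x i)) = x i
          rw [h2, hψ])
  exact ⟨Module.Finite.equiv e.toLinearEquiv, by rw [← e.toLinearEquiv.finrank_eq, hSr]⟩
end

section
/- For every n ≥ 1, the monomial x₁ x₂² x₃³ ⋯ xₙⁿ does not belong to the ideal I; equivalently, its image in the quotient ℝ[x₀,…,xₙ]/I is nonzero. -/
open MvPolynomial

/-- Antisymmetrization. -/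
noncomputable def altz (n : ℕ) (f : MvPolynomial (Fin (n + 1)) ℝ) :
    MvPolynomial (Fin (n + 1)) ℝ :=
  ∑ σ : Equiv.Perm (Fin (n + 1)), C (((Equiv.Perm.sign σ : ℤˣ) : ℤ) : ℝ) * rename σ f

/-- The staircase exponent. -/
noncomputable def stair (n : ℕ) : Fin (n + 1) →₀ ℕ := Finsupp.equivFunOnFinite.symm (fun i => i.val)

lemma altz_rename (n : ℕ) (τ : Equiv.Perm (Fin (n + 1))) (f : MvPolynomial (Fin (n + 1)) ℝ) :
    C (((Equiv.Perm.sign τ : ℤˣ) : ℤ) : ℝ) * rename τ (altz n f) = altz n f := by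
  unfold altz
  rw [map_sum, Finset.mul_sum]
  refine Fintype.sum_equiv (Equiv.mulLeft τ) _ _ (fun σ => ?_)
  simp only [map_mul, rename_C, rename_rename, Equiv.coe_mulLeft, Equiv.Perm.coe_mul,
    Equiv.Perm.sign_mul, Units.val_mul, Int.cast_mul]
  ring

lemma altz_coeff (n : ℕ) (f : MvPolynomial (Fin (n + 1)) ℝ) (d : Fin (n + 1) →₀ ℕ)
    (i j : Fin (n + 1)) (hij : i ≠ j) (h : d i = d j) : coeff d (altz n f) = 0 := by
  have h1 := congrArg (coeff d) (altz_rename n (Equiv.swap i j) f)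
  have h2 : d.mapDomain (Equiv.swap i j) = d := by
    ext k
    rw [← Finsupp.equivMapDomain_eq_mapDomain, Finsupp.equivMapDomain_apply, Equiv.symm_swap]
    rw [Equiv.swap_apply_def]
    split_ifs <;> simp_all
  have h3 := coeff_rename_mapDomain (Equiv.swap i j) (Equiv.injective _) (altz n f) d
  rw [h2] at h3
  rw [coeff_C_mul, h3, Equiv.Perm.sign_swap hij] at h1
  simp at h1
  linarith

lemma stair_min (n : ℕ) (a b : Fin (n + 1) →₀ ℕ) (hab : a + b = stair n)
    (ha : Function.Injective a) : b = 0 := by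
  have hv : ∀ i, a i + b i = i.val := fun i => by
    have := DFunLike.congr_fun hab i
    simpa [stair] using this
  have key : ∀ m : ℕ, ∀ i : Fin (n + 1), i.val = m → a i = i.val := by
    intro m
    induction m using Nat.strong_induction_on with
    | _ m ih =>
      intro i him
      by_contra hne
      have hlt : a i < i.val := by have := hv i; omega
      have h1 := ih (a i) (by omega) ⟨a i, by omega⟩ rfl
      have h2 := ha h1
      have h3 := congrArg Fin.val h2
      simp at h3
      omega
  ext i
  have := hv i
  have := key _ i rfl
  simp
  omega

lemma altz_mul_esymm (n j : ℕ) (hj : 1 ≤ j) (g : MvPolynomial (Fin (n + 1)) ℝ) :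
    coeff (stair n) (altz n (g * esymm (Fin (n + 1)) ℝ j)) = 0 := by
  have h : altz n (g * esymm (Fin (n + 1)) ℝ j) = altz n g * esymm (Fin (n + 1)) ℝ j := by
    unfold altz
    rw [Finset.sum_mul]
    refine Finset.sum_congr rfl fun σ _ => ?_
    rw [map_mul, rename_esymm, mul_assoc]
  rw [h, coeff_mul]
  refine Finset.sum_eq_zero fun p hp => ?_
  rw [Finset.HasAntidiagonal.mem_antidiagonal] at hp
  by_cases hi : Function.Injective p.1
  · rw [stair_min n _ _ hp hi]
    have : coeff 0 (esymm (Fin (n + 1)) ℝ j) = 0 := by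
      rw [← constantCoeff_eq, esymm, map_sum]
      refine Finset.sum_eq_zero fun t ht => ?_
      rw [Finset.mem_powersetCard] at ht
      rw [map_prod]
      obtain ⟨k, hk⟩ : t.Nonempty := Finset.card_pos.mp (by omega)
      exact Finset.prod_eq_zero hk (constantCoeff_X _ _)
    rw [this, mul_zero]
  · simp only [Function.Injective, not_forall] at hi
    obtain ⟨i, k, h1, h2⟩ := hi
    rw [altz_coeff n g _ i k h2 h1, zero_mul]

lemma altz_stair (n : ℕ) : coeff (stair n) (altz n (monomial (stair n) 1)) = 1 := by
  unfold altz
  rw [coeff_sum, Finset.sum_eq_single 1]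
  · simp
  · intro σ _ hσ
    rw [coeff_C_mul, rename_monomial, coeff_monomial, if_neg, mul_zero]
    intro h
    apply hσ
    ext k
    have := DFunLike.congr_fun h (σ k)
    rw [Finsupp.mapDomain_apply σ.injective] at this
    simpa [stair] using this.symm
  · simp

lemma altz_ideal (n : ℕ) (f : MvPolynomial (Fin (n + 1)) ℝ) (hf : f ∈ symIdeal n) :
    ∀ g, coeff (stair n) (altz n (g * f)) = 0 := by
  unfold symIdeal at hf
  induction hf using Submodule.span_induction with
  | mem x hx =>
    obtain ⟨j, hj, rfl⟩ := hx
    exact altz_mul_esymm n j hj.1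
  | zero => intro g; simp [altz]
  | add x y _ _ hx hy =>
    intro g
    have : altz n (g * (x + y)) = altz n (g * x) + altz n (g * y) := by
      simp only [altz, mul_add, map_add, Finset.sum_add_distrib]
    rw [this, coeff_add, hx, hy, add_zero]
  | smul a x _ hx =>
    intro g
    rw [smul_eq_mul, ← mul_assoc]
    exact hx _

/-- The monomial `x₁ x₂² ⋯ xₙⁿ` does not belong to the ideal `I`; here `x_i`
is the variable `X i.succ` for `i : Fin n`, with exponent `i.val + 1`. -/
theorem top_monomial_not_in_ideal (n : ℕ) (hn : 1 ≤ n) :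
    (∏ i : Fin n, (X i.succ : MvPolynomial (Fin (n + 1)) ℝ) ^ (i.val + 1)) ∉
      symIdeal n := by
  intro hmem
  have h := altz_ideal n _ hmem 1
  have h2 : (∏ i : Fin n, (X i.succ : MvPolynomial (Fin (n + 1)) ℝ) ^ (i.val + 1))
      = monomial (stair n) 1 := by
    rw [monomial_eq, Finsupp.prod_fintype _ _ (by simp), Fin.prod_univ_succ]
    simp [stair]
  rw [one_mul, h2, altz_stair] at h
  exact one_ne_zero h
end

section
/- For every n ≥ 2, the power x_{n−1}^{n+1} belongs to the ideal I. -/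
open MvPolynomial

theorem pow_mem_aux (n : ℕ) (i : Fin (n + 1)) :
    (X i : MvPolynomial (Fin (n + 1)) ℝ) ^ (n + 1) ∈ symIdeal n := by
  have h := congrArg (Polynomial.eval (-(X i : MvPolynomial (Fin (n + 1)) ℝ)))
    (MvPolynomial.prod_C_add_X_eq_sum_esymm ℝ (Fin (n + 1)))
  rw [Polynomial.eval_prod, Finset.prod_eq_zero (Finset.mem_univ i) (by simp),
    Polynomial.eval_finset_sum, Fintype.card_fin, Finset.sum_range_succ'] at h
  simp only [Polynomial.eval_mul, Polynomial.eval_C, Polynomial.eval_pow, Polynomial.eval_X,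
    MvPolynomial.esymm_zero, one_mul, Nat.sub_zero] at h
  have h2 : (-(X i : MvPolynomial (Fin (n + 1)) ℝ)) ^ (n + 1) ∈ symIdeal n := by
    rw [eq_neg_of_add_eq_zero_right h.symm]
    refine neg_mem (Ideal.sum_mem _ fun j hj => Ideal.mul_mem_right _ _ (Ideal.subset_span ?_))
    exact ⟨j + 1, ⟨by omega, by have := Finset.mem_range.mp hj; omega⟩, rfl⟩
  rw [neg_pow] at h2
  have h3 := Ideal.mul_mem_left _ ((-1) ^ (n + 1)) h2
  rwa [← mul_assoc, ← mul_pow, neg_one_mul, neg_neg, one_pow, one_mul] at h3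

/-- For `n ≥ 2`, the power `x_{n-1}^{n+1}` belongs to the ideal `I`. -/
theorem pow_sub_one_in_ideal (n : ℕ) (hn : 2 ≤ n) :
    (X (⟨n - 1, by omega⟩ : Fin (n + 1)) : MvPolynomial (Fin (n + 1)) ℝ) ^ (n + 1) ∈
      symIdeal n := by
  exact pow_mem_aux n _
end

section
/- For every n ≥ 1, the images under the quotient map ℝ[x₁,…,xₙ] → ℝ[x₁,…,xₙ]/J of the monomials x₁^{α₁} x₂^{α₂} ⋯ xₙ^{αₙ} with 0 ≤ αᵢ ≤ 2i−1 for 1 ≤ i ≤ n form a basis of the quotient ring as a real vector space. -/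
open MvPolynomial

/-- The ideal `J` generated by `e_j(x₁², …, xₙ²)` for `1 ≤ j ≤ n`. -/
noncomputable def sqSymIdeal (n : ℕ) : Ideal (MvPolynomial (Fin n) ℝ) :=
  Ideal.span ((fun j => MvPolynomial.aeval (fun i => (X i : MvPolynomial (Fin n) ℝ) ^ 2)
    (MvPolynomial.esymm (Fin n) ℝ j)) '' Set.Icc 1 n)

theorem sq_split_exists (n : ℕ) : ∀ (R : Type) [CommRing R] [Nontrivial R] (f : Polynomial R),
    f.Monic → f.natDegree = n →
    ∃ (A : Type) (_ : CommRing A) (_ : Algebra R A) (y : Fin n → A)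
      (b : Module.Basis (∀ i : Fin n, Fin (2 * i.val + 2)) R A),
      (∀ α, b α = ∏ i, y i ^ (α i : ℕ)) ∧
      f.map (algebraMap R A) = ∏ i, (Polynomial.X - Polynomial.C (y i ^ 2)) ∧
      ∀ (B : Type) [CommRing B] (φ : R →+* B) (z : Fin n → B),
        f.map φ = ∏ i, (Polynomial.X - Polynomial.C (z i ^ 2)) →
        ∃ ψ : A →+* B, ψ.comp (algebraMap R A) = φ ∧ ∀ i, ψ (y i) = z i := by
  induction n with
  | zero =>
    intro R _ _ f hf hn
    have h1 : f = 1 := hf.natDegree_eq_zero.mp hn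
    refine ⟨R, inferInstance, inferInstance, Fin.elim0, Module.Basis.singleton _ R, ?_, ?_, ?_⟩
    · intro α
      simp
    · simp [h1]
    · intro B _ φ z _
      exact ⟨φ, by ext; simp, fun i => i.elim0⟩
  | succ n ih =>
    intro R _ _ f hf hn
    have hgm : (Polynomial.expand R 2 f).Monic := hf.expand (by norm_num)
    have hdim : (AdjoinRoot.powerBasis' hgm).dim = 2 * (Fin.last n).val + 2 := by
      rw [AdjoinRoot.powerBasis'_dim, Polynomial.natDegree_expand, hn, Fin.val_last]; ring
    obtain ⟨c, hc⟩ : ∃ c : Module.Basis (Fin (2 * (Fin.last n).val + 2)) R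
        (AdjoinRoot (Polynomial.expand R 2 f)), ∀ i, c i = AdjoinRoot.root _ ^ (i : ℕ) := by
      refine ⟨(AdjoinRoot.powerBasis' hgm).basis.reindex (finCongr hdim), fun i => ?_⟩
      simp [PowerBasis.basis_eq_pow]
    set r := AdjoinRoot.root (Polynomial.expand R 2 f) with hr
    haveI : Nontrivial (AdjoinRoot (Polynomial.expand R 2 f)) :=
      nontrivial_of_ne _ _ (c.ne_zero 0)
    set f' := f.map (algebraMap R (AdjoinRoot (Polynomial.expand R 2 f))) with hf'
    have hroot : f'.IsRoot (r ^ 2) := by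
      have h := AdjoinRoot.eval₂_root (Polynomial.expand R 2 f)
      rw [← AdjoinRoot.algebraMap_eq, ← Polynomial.aeval_def, Polynomial.expand_aeval] at h
      rw [Polynomial.IsRoot, hf', Polynomial.eval_map_algebraMap]
      exact h
    have hmul := Polynomial.mul_divByMonic_eq_iff_isRoot.mpr hroot
    set g := f' /ₘ (Polynomial.X - Polynomial.C (r ^ 2)) with hg
    have hgmon : g.Monic := by
      refine (Polynomial.monic_X_sub_C (r ^ 2)).of_mul_monic_left ?_
      rw [hmul]; exact hf.map _
    have hgdeg : g.natDegree = n := by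
      rw [hg, Polynomial.natDegree_divByMonic _ (Polynomial.monic_X_sub_C _),
        Polynomial.natDegree_X_sub_C, hf', hf.natDegree_map, hn]; rfl
    obtain ⟨A, iA, iAlg, y, b, hb, hprod, huniv⟩ := ih _ g hgmon hgdeg
    letI : Algebra R A := ((algebraMap (AdjoinRoot (Polynomial.expand R 2 f)) A).comp
      (algebraMap R (AdjoinRoot (Polynomial.expand R 2 f)))).toAlgebra
    haveI : IsScalarTower R (AdjoinRoot (Polynomial.expand R 2 f)) A :=
      IsScalarTower.of_algebraMap_eq' rfl
    refine ⟨A, iA, inferInstance,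
      Fin.snoc (α := fun _ => A) y (algebraMap (AdjoinRoot (Polynomial.expand R 2 f)) A r),
      (c.smulTower b).reindex
        (Fin.snocEquiv (fun i : Fin (n + 1) => Fin (2 * i.val + 2))), ?_, ?_, ?_⟩
    · intro α
      rw [Module.Basis.reindex_apply, Module.Basis.smulTower_apply, hb, hc, Fin.prod_univ_castSucc,
        Algebra.smul_def, mul_comm]
      simp [Fin.snocEquiv, Fin.init]
    · rw [IsScalarTower.algebraMap_eq R (AdjoinRoot (Polynomial.expand R 2 f)) A,
        ← Polynomial.map_map, ← hf', ← hmul, Polynomial.map_mul, hprod, Fin.prod_univ_castSucc,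
        mul_comm]
      simp
    · intro B _ φ z hz
      have h0 : Polynomial.eval₂ φ (z (Fin.last n)) (Polynomial.expand R 2 f) = 0 := by
        rw [← Polynomial.eval_map, Polynomial.map_expand, Polynomial.expand_eval, hz,
          Polynomial.eval_prod]
        exact Finset.prod_eq_zero (Finset.mem_univ (Fin.last n)) (by simp)
      have hφ : (AdjoinRoot.lift φ _ h0).comp
          (algebraMap R (AdjoinRoot (Polynomial.expand R 2 f))) = φ :=
        AdjoinRoot.lift_comp_of h0
      have hφr : AdjoinRoot.lift φ _ h0 r = z (Fin.last n) := AdjoinRoot.lift_root h0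
      have hgz : g.map (AdjoinRoot.lift φ _ h0) =
          ∏ i : Fin n, (Polynomial.X - Polynomial.C (z i.castSucc ^ 2)) := by
        apply (Polynomial.monic_X_sub_C (z (Fin.last n) ^ 2)).isRegular.left
        have h2 := congrArg (Polynomial.map (AdjoinRoot.lift φ _ h0)) hmul
        rw [hf', Polynomial.map_map, hφ, hz, Fin.prod_univ_castSucc, Polynomial.map_mul,
          Polynomial.map_sub, Polynomial.map_X, Polynomial.map_C, map_pow, hφr] at h2
        simp only
        rw [h2, mul_comm]
      obtain ⟨ψ, h1, h2⟩ := huniv B _ _ hgz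
      refine ⟨ψ, ?_, ?_⟩
      · rw [IsScalarTower.algebraMap_eq R (AdjoinRoot (Polynomial.expand R 2 f)) A,
          ← RingHom.comp_assoc, h1, hφ]
      · intro i
        refine Fin.lastCases ?_ (fun i => ?_) i
        · rw [Fin.snoc_last, ← RingHom.comp_apply, h1, hφr]
        · rw [Fin.snoc_castSucc, h2]

theorem sq_prod_iff {n : ℕ} {B : Type} [CommRing B] (w : Fin n → B) :
    (Polynomial.X ^ n = ∏ i, (Polynomial.X - Polynomial.C (w i))) ↔
      ∀ j ∈ Set.Icc 1 n, (Multiset.map w Finset.univ.val).esymm j = 0 := by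
  have hp : ∏ i, (Polynomial.X - Polynomial.C (w i)) =
      (Multiset.map (fun t => Polynomial.X - Polynomial.C t)
        (Multiset.map w Finset.univ.val)).prod := by
    rw [Multiset.map_map]; rfl
  have hcard : (Multiset.map w Finset.univ.val).card = n := by simp
  constructor
  · rintro h j ⟨h1, h2⟩
    have h3 := Multiset.prod_X_sub_C_coeff (Multiset.map w Finset.univ.val) (k := n - j)
      (by rw [hcard]; omega)
    rw [← hp, ← h, hcard, Polynomial.coeff_X_pow, if_neg (by omega),
      show n - (n - j) = j by omega] at h3
    have h4 : ((-1 : B) ^ j) * ((-1) ^ j) = 1 := by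
      rw [← mul_pow]; simp
    calc _ = ((-1 : B) ^ j) * ((-1) ^ j) * (Multiset.map w Finset.univ.val).esymm j := by
          rw [h4, one_mul]
      _ = 0 := by rw [mul_assoc, ← h3, mul_zero]
  · intro h
    rw [hp, Multiset.prod_X_sub_X_eq_sum_esymm, hcard, Finset.sum_eq_single 0]
    · simp [Multiset.esymm]
    · intro j hj hj0
      rw [h j ⟨by omega, by simpa [Nat.lt_succ_iff] using hj⟩]
      simp
    · simp

/-- The images in the quotient `ℝ[x₁,…,xₙ]/J` of the monomials
`x₁^{α₁} ⋯ xₙ^{αₙ}` with `0 ≤ αᵢ ≤ 2i - 1` form a basis of the quotient as a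
real vector space.  Here `x_i` is the variable `X` at index `i - 1` in `Fin n`,
so the exponent of the variable of index `i : Fin n` ranges over
`0, …, 2(i.val+1) - 1 = 2 i.val + 1`, i.e. over `Fin (2 * i.val + 2)`. -/
theorem basis_of_sq_quotient (n : ℕ) (hn : 1 ≤ n) :
    LinearIndependent ℝ
      (fun α : (∀ i : Fin n, Fin (2 * i.val + 2)) =>
        Ideal.Quotient.mk (sqSymIdeal n)
          (∏ i : Fin n, (X i : MvPolynomial (Fin n) ℝ) ^ (α i : ℕ))) ∧
    Submodule.span ℝ
      (Set.range (fun α : (∀ i : Fin n, Fin (2 * i.val + 2)) =>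
        Ideal.Quotient.mk (sqSymIdeal n)
          (∏ i : Fin n, (X i : MvPolynomial (Fin n) ℝ) ^ (α i : ℕ)))) = ⊤ := by
  obtain ⟨A, _, _, y, b, hb, hprod, huniv⟩ := sq_split_exists n ℝ (Polynomial.X ^ n)
    (Polynomial.monic_X_pow n) (Polynomial.natDegree_X_pow n)
  rw [Polynomial.map_pow, Polynomial.map_X, sq_prod_iff] at hprod
  have hJ : ∀ a ∈ sqSymIdeal n, (aeval y : MvPolynomial (Fin n) ℝ →ₐ[ℝ] A) a = 0 := by
    intro a ha
    have hle : sqSymIdeal n ≤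
        RingHom.ker (aeval y : MvPolynomial (Fin n) ℝ →ₐ[ℝ] A) := by
      rw [sqSymIdeal, Ideal.span_le]
      rintro _ ⟨j, hj, rfl⟩
      simp only [SetLike.mem_coe, RingHom.mem_ker]
      rw [← AlgHom.comp_apply, comp_aeval, aeval_esymm_eq_multiset_esymm]
      simpa using hprod j hj
    exact hle ha
  let θ : (MvPolynomial (Fin n) ℝ ⧸ sqSymIdeal n) →ₐ[ℝ] A :=
    Ideal.Quotient.liftₐ _ (aeval y) hJ
  have hθ : ∀ p, θ (Ideal.Quotient.mk (sqSymIdeal n) p) = aeval y p := fun p => rfl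
  obtain ⟨ψ, hψ1, hψ2⟩ := huniv (MvPolynomial (Fin n) ℝ ⧸ sqSymIdeal n) (algebraMap ℝ _)
    (fun i => Ideal.Quotient.mk (sqSymIdeal n) (X i)) (by
      rw [Polynomial.map_pow, Polynomial.map_X, sq_prod_iff]
      intro j hj
      have h : Ideal.Quotient.mkₐ ℝ (sqSymIdeal n) (aeval (fun i => (X i) ^ 2)
          (esymm (Fin n) ℝ j)) = 0 :=
        Ideal.Quotient.eq_zero_iff_mem.mpr (Ideal.subset_span ⟨j, hj, rfl⟩)
      rw [← AlgHom.comp_apply, comp_aeval, aeval_esymm_eq_multiset_esymm] at h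
      simpa using h)
  let Ψ : A →ₐ[ℝ] (MvPolynomial (Fin n) ℝ ⧸ sqSymIdeal n) :=
    AlgHom.mk ψ (fun r => RingHom.congr_fun hψ1 r)
  have hΨ : ∀ i, Ψ (y i) = Ideal.Quotient.mk (sqSymIdeal n) (X i) := hψ2
  have hcomp : Ψ.comp θ = AlgHom.id ℝ _ := by
    apply Ideal.Quotient.algHom_ext
    apply MvPolynomial.algHom_ext
    intro i
    simp [hθ, hΨ]
  constructor
  · apply LinearIndependent.of_comp θ.toLinearMap
    convert b.linearIndependent using 1
    ext α
    simp [hb, hθ]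
  · have hfun : (fun α : (∀ i : Fin n, Fin (2 * i.val + 2)) =>
        Ideal.Quotient.mk (sqSymIdeal n)
          (∏ i : Fin n, (X i : MvPolynomial (Fin n) ℝ) ^ (α i : ℕ))) = Ψ.toLinearMap ∘ b := by
      ext α
      simp [hb, hΨ]
    rw [hfun, Set.range_comp, Submodule.span_image, b.span_eq, Submodule.map_top,
      LinearMap.range_eq_top]
    intro q
    exact ⟨θ q, DFunLike.congr_fun hcomp q⟩
end

section
/- For every n ≥ 1, the quotient ring ℝ[x₁,…,xₙ]/J is a finite-dimensional real vector space of dimension 2ⁿ · n!. -/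
open MvPolynomial

theorem univ_split (n : ℕ) : ∀ (R : Type) [CommRing R] [Nontrivial R] (f : Polynomial R),
    f.Monic → f.natDegree = n →
    ∃ (A : Type) (_ : CommRing A) (_ : Algebra R A) (x : Fin n → A),
      Nonempty (Module.Basis (Fin (2 ^ n * Nat.factorial n)) R A) ∧
      f.map (algebraMap R A) = ∏ i, (Polynomial.X - Polynomial.C (x i ^ 2)) ∧
      (∀ (B : Type) [CommRing B] (φ : R →+* B) (y : Fin n → B),
        f.map φ = ∏ i, (Polynomial.X - Polynomial.C (y i ^ 2)) →
        ∃ ψ : A →+* B, ψ.comp (algebraMap R A) = φ ∧ ∀ i, ψ (x i) = y i) ∧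
      (∀ (B : Type) [CommRing B] (ψ₁ ψ₂ : A →+* B),
        ψ₁.comp (algebraMap R A) = ψ₂.comp (algebraMap R A) →
        (∀ i, ψ₁ (x i) = ψ₂ (x i)) → ψ₁ = ψ₂) := by
  induction n with
  | zero =>
    intro R _ _ f hf hd
    have h1 : f = 1 := hf.natDegree_eq_zero.mp hd
    subst h1
    refine ⟨R, inferInstance, inferInstance, Fin.elim0, ?_, by simp, ?_, ?_⟩
    · exact ⟨(Module.Basis.singleton (Fin 1) R).reindex (finCongr (by simp))⟩
    · intro B _ φ y _
      exact ⟨φ, by ext; simp, fun i => i.elim0⟩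
    · intro B _ ψ₁ ψ₂ h _
      simpa using h
  | succ n ih =>
    intro R _ _ f hf hd
    set p := Polynomial.expand R 2 f with hp
    have hpm : p.Monic := (Polynomial.monic_expand_iff (by norm_num)).2 hf
    have hpd : p.natDegree = (n + 1) * 2 := by rw [hp, Polynomial.natDegree_expand, hd]
    let b : Module.Basis (Fin ((n + 1) * 2)) R (AdjoinRoot p) :=
      (AdjoinRoot.powerBasis' hpm).basis.reindex (finCongr (by simpa using hpd))
    have : Nontrivial (AdjoinRoot p) := ⟨b ⟨0, by omega⟩, 0, b.ne_zero _⟩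
    set r := AdjoinRoot.root p with hr
    have hroot : (f.map (AdjoinRoot.of p)).IsRoot (r ^ 2) := by
      have := AdjoinRoot.isRoot_root p
      rwa [Polynomial.IsRoot, hp, Polynomial.map_expand, Polynomial.expand_eval] at this
    obtain ⟨g, hg⟩ := Polynomial.dvd_iff_isRoot.2 hroot
    have hgm : g.Monic := (Polynomial.monic_X_sub_C _).of_mul_monic_left (hg ▸ hf.map _)
    have hgd : g.natDegree = n := by
      have h := congrArg Polynomial.natDegree hg
      rw [hf.natDegree_map, hd, (Polynomial.monic_X_sub_C _).natDegree_mul hgm,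
        Polynomial.natDegree_X_sub_C] at h
      omega
    obtain ⟨A, _, _, x, ⟨c⟩, hx, hex, huniq⟩ := ih (AdjoinRoot p) g hgm hgd
    let _ : Algebra R A := ((algebraMap (AdjoinRoot p) A).comp (AdjoinRoot.of p)).toAlgebra
    have halg : algebraMap R A = (algebraMap (AdjoinRoot p) A).comp (AdjoinRoot.of p) := rfl
    have : IsScalarTower R (AdjoinRoot p) A := IsScalarTower.of_algebraMap_eq' rfl
    refine ⟨A, inferInstance, inferInstance,
      Fin.cons (algebraMap (AdjoinRoot p) A r) x, ?_, ?_, ?_, ?_⟩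
    · refine ⟨(b.smulTower c).reindex (finProdFinEquiv.trans (finCongr ?_))⟩
      rw [Nat.factorial_succ, pow_succ]; ring
    · rw [halg, ← Polynomial.map_map, hg, Polynomial.map_mul, hx, Fin.prod_univ_succ]
      simp
    · intro B _ φ y hy
      have h0 : p.eval₂ φ (y 0) = 0 := by
        rw [Polynomial.eval₂_eq_eval_map, hp, Polynomial.map_expand, Polynomial.expand_eval, hy,
          Polynomial.eval_prod]
        exact Finset.prod_eq_zero (Finset.mem_univ 0) (by simp)
      have h1 : g.map (AdjoinRoot.lift φ (y 0) h0)
          = ∏ i : Fin n, (Polynomial.X - Polynomial.C (y i.succ ^ 2)) := by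
        rw [Fin.prod_univ_succ] at hy
        have h2 := congrArg (Polynomial.map (AdjoinRoot.lift φ (y 0) h0)) hg
        rw [Polynomial.map_map, AdjoinRoot.lift_comp_of, hy, Polynomial.map_mul] at h2
        rw [Polynomial.map_sub, Polynomial.map_X, Polynomial.map_C, hr,
          map_pow (AdjoinRoot.lift φ (y 0) h0), AdjoinRoot.lift_root] at h2
        exact ((Polynomial.monic_X_sub_C (y 0 ^ 2)).isRegular.left h2).symm
      obtain ⟨ψ, hψ, hψx⟩ := hex B _ _ h1
      refine ⟨ψ, ?_, ?_⟩
      · rw [halg, ← RingHom.comp_assoc, hψ, AdjoinRoot.lift_comp_of]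
      · intro i
        refine Fin.cases ?_ (fun i => ?_) i
        · have := congrArg (fun t => t r) hψ
          simpa [hr] using this
        · simpa using hψx i
    · intro B _ ψ₁ ψ₂ h hi
      apply huniq
      · apply AdjoinRoot.ringHom_ext
        · exact h
        · simpa using hi 0
      · intro i
        simpa using hi i.succ

theorem X_pow_eq_iff {B : Type} [CommRing B] (n : ℕ) (y : Fin n → B) :
    (Polynomial.X ^ n = ∏ i, (Polynomial.X - Polynomial.C (y i))) ↔
      ∀ j ∈ Set.Icc 1 n, (Finset.univ.val.map y).esymm j = 0 := by
  have hcard : Multiset.card (Finset.univ.val.map y) = n := by simp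
  have hprod : ∏ i, (Polynomial.X - Polynomial.C (y i)) =
      ((Finset.univ.val.map y).map fun t => Polynomial.X - Polynomial.C t).prod := by
    rw [Multiset.map_map]; rfl
  rw [hprod]
  constructor
  · intro h j hj
    have h1 := congrArg (fun q => Polynomial.coeff q (n - j)) h
    rw [Multiset.prod_X_sub_C_coeff _ (by rw [hcard]; omega), hcard, Polynomial.coeff_X_pow,
      if_neg (by have := hj.1; have := hj.2; omega), Nat.sub_sub_self hj.2] at h1
    have h2 : (-1 : B) ^ j * ((-1) ^ j * (Finset.univ.val.map y).esymm j) = 0 := by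
      rw [← h1, mul_zero]
    rwa [← mul_assoc, ← mul_pow, neg_one_mul, neg_neg, one_pow, one_mul] at h2
  · intro h
    rw [Multiset.prod_X_sub_X_eq_sum_esymm, hcard, Finset.sum_range_succ', Finset.sum_eq_zero]
    · simp [Multiset.esymm]
    · intro j hj
      rw [h (j + 1) ⟨by omega, by have := Finset.mem_range.1 hj; omega⟩]
      simp

/-- The quotient `ℝ[x₁,…,xₙ]/J` is a finite-dimensional real vector space of
dimension `2ⁿ · n!`. -/
theorem finrank_sq_quotient (n : ℕ) (hn : 1 ≤ n) :
    Module.Finite ℝ (MvPolynomial (Fin n) ℝ ⧸ sqSymIdeal n) ∧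
    Module.finrank ℝ (MvPolynomial (Fin n) ℝ ⧸ sqSymIdeal n) =
      2 ^ n * Nat.factorial n := by
  obtain ⟨A, _, _, x, ⟨b⟩, hx, hex, huniq⟩ := univ_split n ℝ (Polynomial.X ^ n)
    (Polynomial.monic_X_pow n) (Polynomial.natDegree_X_pow n)
  rw [Polynomial.map_pow, Polynomial.map_X, X_pow_eq_iff n (fun i => x i ^ 2)] at hx
  let F : (MvPolynomial (Fin n) ℝ ⧸ sqSymIdeal n) →ₐ[ℝ] A :=
    Ideal.Quotient.liftₐ (sqSymIdeal n) (MvPolynomial.aeval x) (by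
      have : sqSymIdeal n ≤ RingHom.ker (MvPolynomial.aeval x : MvPolynomial (Fin n) ℝ →ₐ[ℝ] A) := by
        rw [sqSymIdeal, Ideal.span_le]
        rintro _ ⟨j, hj, rfl⟩
        have h := hx j hj
        rw [← MvPolynomial.aeval_esymm_eq_multiset_esymm (Fin n) ℝ] at h
        simp only [SetLike.mem_coe, RingHom.mem_ker]
        rw [← AlgHom.comp_apply, MvPolynomial.comp_aeval]
        simpa using h
      intro a ha
      exact this ha)
  have hF : ∀ i, F (Ideal.Quotient.mk _ (X i)) = x i := by
    intro i
    change MvPolynomial.aeval x (X i) = x i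
    simp
  obtain ⟨G, hG, hGx⟩ := hex (MvPolynomial (Fin n) ℝ ⧸ sqSymIdeal n) (algebraMap ℝ _)
    (fun i => Ideal.Quotient.mk _ (X i)) (by
      rw [Polynomial.map_pow, Polynomial.map_X,
        X_pow_eq_iff n (fun i => (Ideal.Quotient.mk (sqSymIdeal n) (X i)) ^ 2)]
      intro j hj
      rw [← MvPolynomial.aeval_esymm_eq_multiset_esymm (Fin n) ℝ]
      have h : (Ideal.Quotient.mkₐ ℝ (sqSymIdeal n))
          (MvPolynomial.aeval (fun i => (X i : MvPolynomial (Fin n) ℝ) ^ 2)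
            (MvPolynomial.esymm (Fin n) ℝ j)) = 0 :=
        Ideal.Quotient.eq_zero_iff_mem.2 (Ideal.subset_span ⟨j, hj, rfl⟩)
      rw [← AlgHom.comp_apply, MvPolynomial.comp_aeval] at h
      simpa using h)
  let G' : A →ₐ[ℝ] (MvPolynomial (Fin n) ℝ ⧸ sqSymIdeal n) :=
    { G with commutes' := fun r => congrArg (fun t => t r) hG }
  have hFG : F.comp G' = AlgHom.id ℝ A := by
    apply AlgHom.coe_ringHom_injective
    apply huniq
    · ext r
      exact ((F.comp G').commutes r).trans rfl
    · intro i
      change F (G (x i)) = x i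
      rw [hGx, hF]
  have hGF : G'.comp F = AlgHom.id ℝ _ := by
    apply Ideal.Quotient.algHom_ext
    apply MvPolynomial.algHom_ext
    intro i
    change G (F (Ideal.Quotient.mk _ (X i))) = Ideal.Quotient.mk _ (X i)
    rw [hF, hGx]
  let e : A ≃ₐ[ℝ] (MvPolynomial (Fin n) ℝ ⧸ sqSymIdeal n) := AlgEquiv.ofAlgHom G' F hGF hFG
  let b' := b.map e.toLinearEquiv
  refine ⟨Module.Finite.of_basis b', ?_⟩
  rw [Module.finrank_eq_card_basis b', Fintype.card_fin]
end

section
/- For every n ≥ 1, the monomial x₁ x₂³ x₃⁵ ⋯ xₙ^{2n−1} does not belong to the ideal J; equivalently, its image in the quotient ℝ[x₁,…,xₙ]/J is nonzero. -/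
open MvPolynomial

/-- The exponent vector `(1,3,…,2n-1)`. -/
noncomputable def topExp (n : ℕ) : Fin n →₀ ℕ :=
  Finsupp.equivFunOnFinite.symm (fun i => 2 * i.val + 1)

theorem topExp_apply (n : ℕ) (i : Fin n) : topExp n i = 2 * i.val + 1 := rfl

/-- The alternating sum of the coefficients on the orbit of the top monomial. -/
noncomputable def altL (n : ℕ) : MvPolynomial (Fin n) ℝ →ₗ[ℝ] ℝ :=
  ∑ σ : Equiv.Perm (Fin n), ((Equiv.Perm.sign σ : ℤ) : ℝ) •
    MvPolynomial.lcoeff ℝ ((topExp n).mapDomain σ)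

theorem altL_apply (n : ℕ) (f : MvPolynomial (Fin n) ℝ) :
    altL n f = ∑ σ : Equiv.Perm (Fin n), ((Equiv.Perm.sign σ : ℤ) : ℝ) *
      coeff ((topExp n).mapDomain σ) f := by
  simp [altL]

theorem altL_rename (n : ℕ) (t : Equiv.Perm (Fin n)) (f : MvPolynomial (Fin n) ℝ) :
    altL n (rename t f) = ((Equiv.Perm.sign t : ℤ) : ℝ) * altL n f := by
  rw [altL_apply, altL_apply, ← Equiv.sum_comp (Equiv.mulLeft t), Finset.mul_sum]
  refine Finset.sum_congr rfl fun s _ => ?_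
  have : (topExp n).mapDomain (Equiv.mulLeft t s) = ((topExp n).mapDomain s).mapDomain t := by
    rw [← Finsupp.mapDomain_comp]
    rfl
  rw [this, coeff_rename_mapDomain _ t.injective]
  simp [mul_assoc]

theorem altL_gen (n j : ℕ) (hj : 1 ≤ j) (a : Fin n →₀ ℕ) (r : ℝ) :
    altL n (monomial a r * expand 2 (esymm (Fin n) ℝ j)) = 0 := by
  by_cases ha : Function.Injective a
  · rw [altL_apply]
    refine Finset.sum_eq_zero fun s _ => ?_
    rw [coeff_monomial_mul']
    split_ifs with hle
    · have hb : ∀ i, (topExp n).mapDomain s i = 2 * (s.symm i).val + 1 := by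
        intro i
        rw [Finsupp.mapDomain_equiv_apply, topExp_apply]
      by_cases hodd : ∃ i, ¬ 2 ∣ ((topExp n).mapDomain s - a) i
      · obtain ⟨i, hi⟩ := hodd
        rw [coeff_expand_of_not_dvd _ hi]
        simp
      · push Not at hodd
        have hle' : ∀ i, a i ≤ 2 * (s.symm i).val + 1 := fun i => hb i ▸ hle i
        have hodd' : ∀ i, a i = 2 * (a i / 2) + 1 := by
          intro i
          have h1 := hodd i
          have h2 := hle' i
          rw [Finsupp.tsub_apply, hb] at h1
          omega
        let c : Fin n → Fin n := fun i => ⟨a i / 2, by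
          have := hle' i
          have := (s.symm i).isLt
          omega⟩
        have hc : Function.Injective c := by
          intro i k h
          apply ha
          have : a i / 2 = a k / 2 := congrArg Fin.val h
          rw [hodd' i, hodd' k, this]
        have hsum : ∑ i, (2 * (c i).val + 1) = ∑ i : Fin n, (2 * i.val + 1) :=
          Equiv.sum_comp (Equiv.ofBijective c (Finite.injective_iff_bijective.1 hc))
            (fun i : Fin n => 2 * i.val + 1)
        have hsum2 : ∑ i, (2 * (s.symm i).val + 1) = ∑ i : Fin n, (2 * i.val + 1) :=
          Equiv.sum_comp s.symm (fun i : Fin n => 2 * i.val + 1)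
        have hac : ∀ i, a i = 2 * (c i).val + 1 := hodd'
        have heq : ∑ i, a i = ∑ i, (2 * (s.symm i).val + 1) := by
          rw [hsum2, ← hsum]
          exact Finset.sum_congr rfl fun i _ => hac i
        have heq' := (Finset.sum_eq_sum_iff_of_le (fun i _ => hle' i)).1 heq
        have : (topExp n).mapDomain s - a = 0 := by
          ext i
          rw [Finsupp.tsub_apply, hb, heq' i (Finset.mem_univ _)]
          simp
        rw [this, coeff_expand_zero 2 two_ne_zero]
        have : coeff 0 (esymm (Fin n) ℝ j) = 0 := by
          rw [← constantCoeff_eq, esymm, map_sum]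
          refine Finset.sum_eq_zero fun t ht => ?_
          rw [map_prod]
          have hne : t.Nonempty := by
            rw [← Finset.card_pos, (Finset.mem_powersetCard.1 ht).2]
            exact hj
          obtain ⟨x, hx⟩ := hne
          exact Finset.prod_eq_zero hx (by simp)
        rw [this]
        simp
    · simp
  · simp only [Function.Injective, not_forall] at ha
    obtain ⟨i, k, hik, hne⟩ := ha
    have h := altL_rename n (Equiv.swap i k) (monomial a r * expand 2 (esymm (Fin n) ℝ j))
    have hs : a.mapDomain (Equiv.swap i k) = a := by
      ext l
      rw [Finsupp.mapDomain_equiv_apply, Equiv.symm_swap, Equiv.swap_apply_def]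
      split_ifs with h1 h2
      · rw [h1, hik]
      · rw [h2, hik]
      · rfl
    rw [map_mul, rename_expand, rename_esymm, rename_monomial, hs, Equiv.Perm.sign_swap hne] at h
    push_cast at h
    linarith

theorem altL_ideal (n : ℕ) (f : MvPolynomial (Fin n) ℝ) (hf : f ∈ sqSymIdeal n) :
    ∀ g, altL n (g * f) = 0 := by
  unfold sqSymIdeal at hf
  induction hf using Submodule.span_induction with
  | mem x hx =>
    obtain ⟨j, hj, rfl⟩ := hx
    intro g
    induction g using MvPolynomial.induction_on' with
    | monomial a r => exact altL_gen n j hj.1 a r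
    | add p q hp hq => rw [add_mul, map_add, hp, hq, add_zero]
  | zero => simp
  | add x y _ _ hx hy => intro g; rw [mul_add, map_add, hx, hy, add_zero]
  | smul c x _ hx => intro g; rw [smul_eq_mul, ← mul_assoc]; exact hx _

theorem altL_top (n : ℕ) : altL n (monomial (topExp n) 1) = 1 := by
  rw [altL_apply, Finset.sum_eq_single 1]
  · have : (topExp n).mapDomain (1 : Equiv.Perm (Fin n)) = topExp n := Finsupp.mapDomain_id
    rw [this]
    simp
  · intro s _ hs
    rw [coeff_monomial, if_neg, mul_zero]
    intro h
    apply hs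
    ext i
    have := DFunLike.congr_fun h (s i)
    rw [Finsupp.mapDomain_equiv_apply, topExp_apply, topExp_apply, Equiv.symm_apply_apply] at this
    simp
    omega
  · simp

/-- The monomial `x₁ x₂³ x₃⁵ ⋯ xₙ^{2n-1}` does not belong to the ideal `J`;
here `x_i` is the variable of index `i - 1` in `Fin n`, so the variable of
index `i : Fin n` has exponent `2(i.val+1) - 1 = 2 i.val + 1`. -/
theorem top_monomial_not_in_ideal_sq (n : ℕ) (hn : 1 ≤ n) :
    (∏ i : Fin n, (X i : MvPolynomial (Fin n) ℝ) ^ (2 * i.val + 1)) ∉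
      sqSymIdeal n := by
  intro h
  have h1 := altL_ideal n _ h 1
  have h2 : (∏ i : Fin n, (X i : MvPolynomial (Fin n) ℝ) ^ (2 * i.val + 1)) =
      monomial (topExp n) 1 := by
    rw [monomial_eq, Finsupp.prod_fintype _ _ (by simp)]
    simp [topExp_apply]
  rw [one_mul, h2, altL_top] at h1
  exact one_ne_zero h1
end

section
/- For every n ≥ 2, the power x_{n−1}^{2n} belongs to the ideal J. -/
open MvPolynomial

/-- For `n ≥ 2`, the power `x_{n-1}^{2n}` belongs to the ideal `J`; here
`x_{n-1}` is the variable of index `n - 2` in `Fin n`. -/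
theorem pow_sub_one_in_ideal_sq (n : ℕ) (hn : 2 ≤ n) :
    (X (⟨n - 2, by omega⟩ : Fin n) : MvPolynomial (Fin n) ℝ) ^ (2 * n) ∈
      sqSymIdeal n := by
  generalize (⟨n - 2, by omega⟩ : Fin n) = a
  have h := congrArg (Polynomial.eval ((X a : MvPolynomial (Fin n) ℝ) ^ 2))
    (Multiset.prod_X_sub_X_eq_sum_esymm
      ((Finset.univ : Finset (Fin n)).val.map (fun i => (X i : MvPolynomial (Fin n) ℝ) ^ 2)))
  rw [Multiset.map_map] at h
  change Polynomial.eval _ (∏ i : Fin n, (Polynomial.X - Polynomial.C ((X i : MvPolynomial (Fin n) ℝ) ^ 2))) = _ at h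
  rw [Polynomial.eval_prod, Finset.prod_eq_zero (Finset.mem_univ a) (by simp),
    Polynomial.eval_finsetSum, Finset.sum_range_succ'] at h
  have h0 : Multiset.card ((Finset.univ : Finset (Fin n)).val.map
      (fun i => (X i : MvPolynomial (Fin n) ℝ) ^ 2)) = n := by simp
  rw [h0] at h
  simp only [← MvPolynomial.aeval_esymm_eq_multiset_esymm (Fin n) ℝ] at h
  simp only [Polynomial.eval_mul, Polynomial.eval_pow, Polynomial.eval_neg, Polynomial.eval_one,
    Polynomial.eval_C, Polynomial.eval_X, pow_zero, one_mul, MvPolynomial.esymm_zero, map_one,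
    Nat.sub_zero, ← pow_mul] at h
  rw [eq_neg_of_add_eq_zero_right h.symm]
  refine neg_mem (sum_mem fun j hj => ?_)
  refine Ideal.mul_mem_left _ _ (Ideal.mul_mem_right _ _ (Ideal.subset_span ⟨j + 1, ?_, rfl⟩))
  have := Finset.mem_range.1 hj
  exact ⟨by omega, by omega⟩
end

section
/- For every n ≥ 2 and every p with 1 ≤ p ≤ n, the polynomial Σ_{i₁+⋯+i_p = n, i_j ≥ 1} x_{n−p+1}^{2i_p−1} x_{n−p+2}^{2i_{p−1}−1} ⋯ xₙ^{2i_1−1} — equivalently, the product (x_{n−p+1} x_{n−p+2} ⋯ xₙ) · h_{n−p}(x_{n−p+1}², …, xₙ²), where h_m denotes the complete homogeneous symmetric polynomial of degree m — belongs to the ideal K. -/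
open MvPolynomial

/-- The complete homogeneous symmetric polynomial of degree `m` evaluated at
the squares of the variables `X i` for `i ∈ S`. -/
noncomputable def completeHomoSq (n : ℕ) (S : Finset (Fin n)) (m : ℕ) :
    MvPolynomial (Fin n) ℝ :=
  ∑ μ : Sym {i // i ∈ S} m, ((μ : Multiset {i // i ∈ S}).map
    (fun i => (X (i : Fin n) : MvPolynomial (Fin n) ℝ) ^ 2)).prod

/-- The ideal `K` generated by `e_j(x₁², …, xₙ²)` for `1 ≤ j ≤ n` together
with the monomial `x₁ x₂ ⋯ xₙ`. -/
noncomputable def sqSymIdealD (n : ℕ) : Ideal (MvPolynomial (Fin n) ℝ) :=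
  Ideal.span (((fun j => MvPolynomial.aeval (fun i => (X i : MvPolynomial (Fin n) ℝ) ^ 2)
    (MvPolynomial.esymm (Fin n) ℝ j)) '' Set.Icc 1 n) ∪
    {∏ i : Fin n, (X i : MvPolynomial (Fin n) ℝ)})

theorem chs_eq_coeff (n : ℕ) (S : Finset (Fin n)) (m : ℕ) :
    completeHomoSq n S m = PowerSeries.coeff m
      (∏ i ∈ S, PowerSeries.mk (fun k => ((X i : MvPolynomial (Fin n) ℝ) ^ 2) ^ k)) := by
  rw [PowerSeries.coeff_prod, completeHomoSq, ← Finset.sum_coe_sort (Finset.finsuppAntidiag S m)]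
  symm
  refine Fintype.sum_equiv (Finset.finsuppAntidiagEquiv S m) _ _ (fun l => ?_)
  have hb : ∀ M : Multiset {i // i ∈ S}, ((M >>= fun a => pure (a : Fin n)) : Multiset (Fin n)) =
      Multiset.map Subtype.val M := by
    intro M
    simp only [Multiset.bind_def, Multiset.pure_def, Multiset.bind_singleton]
  rw [hb, Multiset.map_map, Finset.prod_multiset_map_count]
  symm
  rw [Finset.prod_subset (Finset.subset_univ _)]
  · rw [← Finset.prod_coe_sort S]
    refine Finset.prod_congr rfl (fun a _ => ?_)
    have := Finset.count_coe_finsuppAntidiagEquiv_apply m l a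
    simp only [PowerSeries.coeff_mk]
    rw [← this]
    simp only [Function.comp]
  · intro x _ hx
    rw [Multiset.mem_toFinset] at hx
    rw [Multiset.count_eq_zero_of_notMem hx, pow_zero]

theorem coeff_prod_one_sub {A ι : Type*} [CommRing A] [DecidableEq ι] (y : ι → A) (T : Finset ι)
    (m : ℕ) :
    PowerSeries.coeff m (∏ i ∈ T, (1 - PowerSeries.C (y i) * PowerSeries.X)) =
      (-1) ^ m * ∑ t ∈ T.powersetCard m, ∏ i ∈ t, y i := by
  have h : ∀ t : Finset ι, ∏ i ∈ t, (-(PowerSeries.C (y i) * PowerSeries.X)) =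
      PowerSeries.C ((-1) ^ t.card * ∏ i ∈ t, y i) * PowerSeries.X ^ t.card := by
    intro t
    rw [Finset.prod_neg, Finset.prod_mul_distrib]
    simp [mul_assoc]
  simp only [sub_eq_add_neg]
  rw [Finset.prod_one_add, map_sum, Finset.mul_sum, Finset.powersetCard_eq_filter, Finset.sum_filter]
  refine Finset.sum_congr rfl (fun t _ => ?_)
  rw [h, PowerSeries.coeff_C_mul, PowerSeries.coeff_X_pow]
  by_cases hm : t.card = m
  · subst hm; simp
  · simp [hm, Ne.symm hm]

theorem geom_mul {A : Type*} [CommRing A] (a : A) :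
    PowerSeries.mk (fun k => a ^ k) * (1 - PowerSeries.C a * PowerSeries.X) = 1 := by
  ext k
  rw [mul_sub, mul_one, ← mul_assoc, map_sub]
  cases k with
  | zero => simp
  | succ k =>
    rw [PowerSeries.coeff_succ_mul_X, PowerSeries.coeff_mul_C]
    simp [PowerSeries.coeff_one, pow_succ]

theorem coeff_geom {A ι : Type*} [CommRing A] [Fintype ι] [DecidableEq ι] (y : ι → A)
    (S : Finset ι)
    (hy : ∀ m, 1 ≤ m → m ≤ Fintype.card ι →
      ∑ t ∈ (Finset.univ : Finset ι).powersetCard m, ∏ i ∈ t, y i = 0) :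
    PowerSeries.coeff Sᶜ.card (∏ i ∈ S, PowerSeries.mk (fun k => y i ^ k)) =
      (-1) ^ Sᶜ.card * ∏ i ∈ Sᶜ, y i := by
  have hall : ∏ i : ι, (1 - PowerSeries.C (y i) * PowerSeries.X) = 1 := by
    ext m
    rw [coeff_prod_one_sub]
    rcases Nat.eq_zero_or_pos m with rfl | hm
    · simp
    · rw [PowerSeries.coeff_one, if_neg hm.ne']
      by_cases hc : m ≤ Fintype.card ι
      · rw [hy m hm hc, mul_zero]
      · rw [Finset.powersetCard_eq_empty.2 (by simpa using hc)]; simp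
  have hS : (∏ i ∈ S, PowerSeries.mk (fun k => y i ^ k)) *
      ∏ i ∈ S, (1 - PowerSeries.C (y i) * PowerSeries.X) = 1 := by
    rw [← Finset.prod_mul_distrib]
    exact Finset.prod_eq_one (fun i _ => geom_mul _)
  rw [← Finset.prod_mul_prod_compl S] at hall
  have : ∏ i ∈ S, PowerSeries.mk (fun k => y i ^ k) =
      ∏ i ∈ Sᶜ, (1 - PowerSeries.C (y i) * PowerSeries.X) := by
    calc _ = (∏ i ∈ S, PowerSeries.mk (fun k => y i ^ k)) * 1 := (mul_one _).symm
      _ = _ := by conv_lhs => rw [← hall, ← mul_assoc, hS, one_mul]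
  rw [this, coeff_prod_one_sub, Finset.powersetCard_self, Finset.sum_singleton]

/-- For `1 ≤ p ≤ n`, the polynomial
`(x_{n-p+1} ⋯ xₙ) · h_{n-p}(x_{n-p+1}², …, xₙ²)` lies in the ideal `K`.
Here `x_i` is the variable of index `i - 1` in `Fin n`, so the variables
`x_{n-p+1}, …, xₙ` are those of index `≥ n - p`. -/
theorem odd_relation_in_ideal (n : ℕ) (hn : 2 ≤ n) (p : ℕ) (hp1 : 1 ≤ p) (hpn : p ≤ n) :
    (∏ i ∈ Finset.univ.filter (fun i : Fin n => n - p ≤ (i : ℕ)),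
        (X i : MvPolynomial (Fin n) ℝ)) *
      completeHomoSq n (Finset.univ.filter (fun i => n - p ≤ (i : ℕ))) (n - p) ∈
      sqSymIdealD n := by
  set S := Finset.univ.filter (fun i : Fin n => n - p ≤ (i : ℕ)) with hS
  have hcard : Sᶜ.card = n - p := by
    have : Sᶜ = Finset.univ.filter (fun i : Fin n => (i : ℕ) < n - p) := by
      ext i; simp only [hS, Finset.mem_compl, Finset.mem_filter, Finset.mem_univ, true_and, not_le]
    rw [this, Fin.card_filter_val_lt]
    omega
  rw [← Ideal.Quotient.eq_zero_iff_mem, map_mul]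
  have hy : ∀ m, 1 ≤ m → m ≤ Fintype.card (Fin n) →
      ∑ t ∈ (Finset.univ : Finset (Fin n)).powersetCard m, ∏ i ∈ t,
        Ideal.Quotient.mk (sqSymIdealD n) (X i ^ 2) = 0 := by
    intro m h1 h2
    rw [Fintype.card_fin] at h2
    have hmem : MvPolynomial.aeval (fun i => (X i : MvPolynomial (Fin n) ℝ) ^ 2)
        (MvPolynomial.esymm (Fin n) ℝ m) ∈ sqSymIdealD n :=
      Ideal.subset_span (Or.inl ⟨m, ⟨h1, h2⟩, rfl⟩)
    rw [← Ideal.Quotient.eq_zero_iff_mem] at hmem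
    rw [← hmem, MvPolynomial.esymm]
    simp only [map_sum, map_prod, aeval_X]
  have key := coeff_geom _ S hy
  have hmap : Ideal.Quotient.mk (sqSymIdealD n) (completeHomoSq n S (n - p)) =
      PowerSeries.coeff (n - p) (∏ i ∈ S, PowerSeries.mk
        (fun k => (Ideal.Quotient.mk (sqSymIdealD n) (X i ^ 2)) ^ k)) := by
    rw [chs_eq_coeff, PowerSeries.coeff_prod, PowerSeries.coeff_prod]
    simp only [map_sum, map_prod, PowerSeries.coeff_mk, map_pow]
  rw [hmap, ← hcard, key]
  have hX : Ideal.Quotient.mk (sqSymIdealD n) (∏ i : Fin n, (X i : MvPolynomial (Fin n) ℝ)) = 0 :=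
    Ideal.Quotient.eq_zero_iff_mem.2 (Ideal.subset_span (Or.inr rfl))
  rw [← Finset.prod_mul_prod_compl S, map_mul] at hX
  rw [← map_prod, Finset.prod_pow, map_pow, pow_two]
  linear_combination ((-1) ^ Sᶜ.card *
    Ideal.Quotient.mk (sqSymIdealD n) (∏ i ∈ Sᶜ, (X i : MvPolynomial (Fin n) ℝ))) * hX
end

section
/- For every n ≥ 3 and every k with 2 ≤ k ≤ n−1, the monomial x_k^{2k−1} · x_{k+1}^{2(k+1)−3} · x_{k+2}^{2(k+2)−3} ⋯ xₙ^{2n−3} (that is, x_k^{2k−1} · ∏_{j=k+1}^{n} x_j^{2j−3}, whose exponents read x_k^{2k−1} x_{k+1}^{2k−1} x_{k+2}^{2k+1} ⋯ x_{n−1}^{2n−5} xₙ^{2n−3}) belongs to the ideal K. -/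
section Aux
open Polynomial

/-- Tail ideal. -/
def tailIdeal {A : Type*} [CommRing A] (n : ℕ) (y : ℕ → A) (j : ℕ) : Ideal A :=
  Ideal.span {a | ∃ i, j ≤ i ∧ i < n ∧ a = y i}

variable {A : Type*} [CommRing A]

theorem tail_mem {n : ℕ} (y : ℕ → A) {j i : ℕ} (h : j ≤ i) (h' : i < n) :
    y i ∈ tailIdeal n y j := Ideal.subset_span ⟨i, h, h', rfl⟩

theorem tail_mono {n : ℕ} (y : ℕ → A) {j : ℕ} :
    tailIdeal n y (j+1) ≤ tailIdeal n y j :=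
  Ideal.span_mono (fun a ⟨i, h, h', e⟩ => ⟨i, by omega, h', e⟩)

theorem tail_le {n : ℕ} (y : ℕ → A) {j : ℕ} :
    tailIdeal n y j ≤ Ideal.span {y j} ⊔ tailIdeal n y (j+1) := by
  refine Ideal.span_le.2 ?_
  rintro a ⟨i, h, h', rfl⟩
  rcases h.eq_or_lt with rfl | h
  · exact Ideal.mem_sup_left (Ideal.mem_span_singleton_self _)
  · exact Ideal.mem_sup_right (tail_mem y h h')

theorem ideal_step (m m' : Ideal A) (y : A) (c : ℕ) (hm : m ≤ Ideal.span {y} ⊔ m')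
    (hym : y ∈ m) (hy : y ^ (c+1) ∈ m' * m ^ c) (t : ℕ) (ht : m' ^ t = ⊥) :
    m ^ (c + t) = ⊥ := by
  have h1 : ∀ s ≤ c, m ^ (s+1) ≤ Ideal.span {y ^ (s+1)} ⊔ m' * m ^ s := by
    intro s
    induction s with
    | zero => intro _; simpa using hm
    | succ s ih =>
      intro hs
      calc m ^ (s+1+1) = m ^ (s+1) * m := pow_succ _ _
        _ ≤ (Ideal.span {y ^ (s+1)} ⊔ m' * m ^ s) * m := Ideal.mul_mono_left (ih (by omega))
        _ = Ideal.span {y ^ (s+1)} * m ⊔ m' * m ^ (s+1) := by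
            rw [Ideal.sup_mul, mul_assoc, ← pow_succ]
        _ ≤ _ := by
            refine sup_le ?_ le_sup_right
            refine (Ideal.mul_mono_right hm).trans ?_
            rw [Ideal.mul_sup, Ideal.span_singleton_mul_span_singleton, ← pow_succ]
            refine sup_le le_sup_left (le_sup_of_le_right ?_)
            rw [mul_comm]
            refine Ideal.mul_mono_right ?_
            rw [Ideal.span_singleton_le_iff_mem]
            exact Ideal.pow_mem_pow hym _
  have h2 : m ^ (c+1) ≤ m' * m ^ c := (h1 c le_rfl).trans
    (sup_le ((Ideal.span_singleton_le_iff_mem _).2 hy) le_rfl)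
  have h3 : ∀ t, m ^ (c + t) ≤ m' ^ t * m ^ c := by
    intro t
    induction t with
    | zero => simp
    | succ t ih =>
      calc m ^ (c + (t+1)) = m ^ (c+t) * m := by rw [← add_assoc, pow_succ]
        _ ≤ (m' ^ t * m ^ c) * m := Ideal.mul_mono_left ih
        _ = m' ^ t * m ^ (c+1) := by rw [mul_assoc, ← pow_succ]
        _ ≤ m' ^ t * (m' * m ^ c) := Ideal.mul_mono_right h2
        _ = _ := by rw [← mul_assoc, ← pow_succ]
  have := h3 t
  rw [ht] at this
  simpa using this

theorem coeff_tail (n c : ℕ) (hc : 1 ≤ c) (y : ℕ → A) (G : ℕ → A[X])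
    (hG : ∀ j, c ≤ j → j < n → G (j+1) = G j * (X - C (y j)))
    (hn : G n = X ^ (n-1)) (j : ℕ) (hj : c ≤ j) (hjn : j ≤ n) (r : ℕ) :
    (G j).coeff r ∈ tailIdeal n y j ^ (j - 1 - r) := by
  induction hjn using Nat.decreasingInduction generalizing r with
  | self =>
    rw [hn, coeff_X_pow]
    split_ifs with h
    · subst h; simp
    · simp
  | @of_succ j hjn ih =>
    have key : ∀ s r, j - 1 ≤ r + s → (G j).coeff r ∈ tailIdeal n y j ^ (j - 1 - r) := by
      intro s
      induction s with
      | zero =>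
        intro r hr
        have : j - 1 - r = 0 := by omega
        simp [this]
      | succ s ihs =>
        intro r hr
        by_cases hr' : j - 1 ≤ r
        · have : j - 1 - r = 0 := by omega
          simp [this]
        have h1 := ih (by omega) (r+1)
        rw [hG j hj hjn] at h1
        have e : (G j).coeff r = (G j * (X - C (y j))).coeff (r+1) + y j * (G j).coeff (r+1) := by
          rw [mul_sub, coeff_sub, coeff_mul_X, coeff_mul_C]; ring
        rw [e]
        have h2 := ihs (r+1) (by omega)
        refine Ideal.add_mem _ ?_ ?_
        · have e2 : j + 1 - 1 - (r+1) = j - 1 - r := by omega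
          rw [e2] at h1
          exact Ideal.pow_right_mono (tail_mono y) _ h1
        · have e2 : j - 1 - r = (j - 1 - (r+1)) + 1 := by omega
          rw [e2, pow_succ']
          exact Ideal.mul_mem_mul (tail_mem y le_rfl hjn) h2
    exact key j r (by omega)

theorem root_mem (n c : ℕ) (hc : 1 ≤ c) (y : ℕ → A) (G : ℕ → A[X])
    (hG : ∀ j, c ≤ j → j < n → G (j+1) = G j * (X - C (y j)))
    (hn : G n = X ^ (n-1)) (hd : ∀ j, c ≤ j → j ≤ n → (G j).Monic ∧ (G j).natDegree ≤ j - 1)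
    (hd' : ∀ j, c ≤ j → j ≤ n → (G j).coeff (j-1) = 1)
    (j : ℕ) (hj : c ≤ j) (hjn : j < n) :
    y j ^ (j - 1 + 1) ∈ tailIdeal n y (j+1) * tailIdeal n y j ^ (j-1) := by
  have h0 : (G (j+1)).eval (y j) = 0 := by rw [hG j hj hjn]; simp
  have hdeg := (hd (j+1) (by omega) hjn).2
  rw [eval_eq_sum_range' (n := j+1) (by omega), Finset.sum_range_succ] at h0
  have h1 := hd' (j+1) (by omega) hjn
  simp only [Nat.add_sub_cancel] at h1
  rw [h1, one_mul] at h0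
  have e : y j ^ (j - 1 + 1) = - ∑ r ∈ Finset.range j, (G (j+1)).coeff r * y j ^ r := by
    rw [show j - 1 + 1 = j by omega]; linear_combination h0
  rw [e]
  refine neg_mem (sum_mem fun r hr => ?_)
  have hr := Finset.mem_range.1 hr
  have h2 := coeff_tail n c hc y G hG hn (j+1) (by omega) hjn r
  have h3 : y j ^ r ∈ tailIdeal n y j ^ r := Ideal.pow_mem_pow (tail_mem y le_rfl hjn) r
  have h4 := Ideal.mul_mem_mul h2 h3
  suffices hle : tailIdeal n y (j+1) ^ (j + 1 - 1 - r) * tailIdeal n y j ^ r ≤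
      tailIdeal n y (j+1) * tailIdeal n y j ^ (j-1) from hle h4
  rw [show j + 1 - 1 - r = (j - 1 - r) + 1 by omega, pow_succ', mul_assoc]
  refine Ideal.mul_mono_right ?_
  calc _ ≤ tailIdeal n y j ^ (j-1-r) * tailIdeal n y j ^ r :=
        Ideal.mul_mono_left (Ideal.pow_right_mono (tail_mono y) _)
    _ = _ := by rw [← pow_add]; congr 1; omega

theorem tail_nilp (n c : ℕ) (hc : 1 ≤ c) (hcn : c ≤ n) (y : ℕ → A)
    (h : ∏ i ∈ Finset.range n, (X - C (y i)) = X ^ n)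
    (h0 : ∏ i ∈ Finset.range c, y i = 0) :
    ∀ j, c ≤ j → (hjn : j ≤ n) → tailIdeal n y j ^ (∑ i ∈ Finset.Ico j n, (i - 1) + 1) = ⊥ := by
  nontriviality A
  obtain ⟨g, hg⟩ : (X : A[X]) ∣ ∏ i ∈ Finset.range c, (X - C (y i)) := by
    rw [X_dvd_iff, coeff_zero_eq_eval_zero, eval_prod]
    simp [Finset.prod_neg, h0]
  have hmon : ∀ s : Finset ℕ, (∏ i ∈ s, (X - C (y i))).Monic :=
    fun s => monic_prod_of_monic _ _ fun i _ => monic_X_sub_C _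
  have hgm : g.Monic := by
    have := hmon (Finset.range c)
    rw [hg] at this
    exact monic_X.of_mul_monic_left this
  have hgd : g.natDegree + 1 = c := by
    have := congrArg natDegree hg
    rw [natDegree_prod_of_monic _ _ (fun i _ => monic_X_sub_C _), monic_X.natDegree_mul hgm] at this
    simp at this
    omega
  set G : ℕ → A[X] := fun j => g * ∏ i ∈ Finset.Ico c j, (X - C (y i)) with hGdef
  have hG : ∀ j, c ≤ j → j < n → G (j+1) = G j * (X - C (y j)) := by
    intro j hj _
    simp only [hGdef]
    rw [Finset.prod_Ico_succ_top hj, mul_assoc]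
  have hn : G n = X ^ (n-1) := by
    have : X * G n = X * X ^ (n-1) := by
      simp only [hGdef]
      rw [← mul_assoc, ← hg, Finset.prod_range_mul_prod_Ico _ hcn, h, ← pow_succ']
      congr 1; omega
    exact monic_X.isRegular.left this
  have hGm : ∀ j, (G j).Monic := fun j => hgm.mul (hmon _)
  have hGd : ∀ j, c ≤ j → (G j).natDegree = j - 1 := by
    intro j hj
    simp only [hGdef]
    rw [hgm.natDegree_mul (hmon _), natDegree_prod_of_monic _ _ (fun i _ => monic_X_sub_C _)]
    simp
    omega
  intro j hj hjn
  induction hjn using Nat.decreasingInduction with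
  | self =>
    simp [tailIdeal]
    intro a x h1 h2; omega
  | @of_succ j hjn ih =>
    have h5 := ih (by omega)
    rw [Finset.sum_eq_sum_Ico_succ_bot hjn, add_assoc]
    exact ideal_step _ _ (y j) (j-1) (tail_le y) (tail_mem y le_rfl hjn)
      (root_mem n c hc y G hG hn (fun j hj _ => ⟨hGm j, (hGd j hj).le⟩)
        (fun j hj _ => by rw [← hGd j hj]; exact hGm j) j hj hjn) _ h5

theorem mono_zero (n c : ℕ) (hc : 1 ≤ c) (hcn : c < n) (y : ℕ → A)
    (h : ∏ i ∈ Finset.range n, (X - C (y i)) = X ^ n)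
    (h0 : ∏ i ∈ Finset.range c, y i = 0) :
    ∏ i ∈ Finset.Ico c n, y i ^ (if i = c then c else i - 1) = 0 := by
  have h1 := tail_nilp n c hc hcn.le y h h0 c le_rfl hcn.le
  rw [← Ideal.mem_bot, ← h1]
  have h2 : ∑ i ∈ Finset.Ico c n, (i - 1) + 1
      = ∑ i ∈ Finset.Ico c n, (if i = c then c else i - 1) := by
    rw [Finset.sum_eq_sum_Ico_succ_bot hcn, Finset.sum_eq_sum_Ico_succ_bot hcn]
    have : ∑ i ∈ Finset.Ico (c+1) n, (if i = c then c else i - 1)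
        = ∑ i ∈ Finset.Ico (c+1) n, (i - 1) := by
      refine Finset.sum_congr rfl fun i hi => ?_
      rw [if_neg]
      have := (Finset.mem_Ico.1 hi).1
      omega
    rw [this, if_pos rfl]; omega
  rw [h2, ← Finset.prod_pow_eq_pow_sum]
  exact Ideal.prod_mem_prod fun i hi =>
    Ideal.pow_mem_pow (tail_mem y (Finset.mem_Ico.1 hi).1 (Finset.mem_Ico.1 hi).2) _

theorem prod_eq_X_pow (n : ℕ) (I : Ideal (MvPolynomial (Fin n) ℝ))
    (hI : ∀ j ∈ Set.Icc 1 n, MvPolynomial.aeval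
      (fun i => (MvPolynomial.X i : MvPolynomial (Fin n) ℝ) ^ 2)
      (MvPolynomial.esymm (Fin n) ℝ j) ∈ I) :
    ∏ i : Fin n, ((X : (MvPolynomial (Fin n) ℝ ⧸ I)[X]) -
      C (Ideal.Quotient.mk I (MvPolynomial.X i ^ 2))) = X ^ n := by
  have e := Multiset.prod_X_sub_X_eq_sum_esymm (Finset.univ.val.map
    (fun i : Fin n => (MvPolynomial.X i : MvPolynomial (Fin n) ℝ) ^ 2))
  rw [Multiset.map_map] at e
  have e' := congrArg (Polynomial.map (Ideal.Quotient.mk I)) e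
  have l : Polynomial.map (Ideal.Quotient.mk I) (Multiset.map ((fun t => X - C t) ∘
      (fun i : Fin n => (MvPolynomial.X i : MvPolynomial (Fin n) ℝ) ^ 2)) Finset.univ.val).prod
      = ∏ i : Fin n, ((X : (MvPolynomial (Fin n) ℝ ⧸ I)[X]) -
      C (Ideal.Quotient.mk I (MvPolynomial.X i ^ 2))) := by
    change Polynomial.map _ (∏ i : Fin n, _) = _
    rw [Polynomial.map_prod]
    simp
  rw [l] at e'
  rw [e', Polynomial.map_sum, Finset.sum_eq_single 0]
  · simp [Multiset.esymm]
  · intro j hj hj0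
    have h := hI j ⟨by omega, by simpa [Nat.lt_succ_iff] using hj⟩
    rw [MvPolynomial.aeval_esymm_eq_multiset_esymm] at h
    simp only [Polynomial.map_mul, Polynomial.map_C, Ideal.Quotient.eq_zero_iff_mem.2 h]
    simp
  · simp

end Aux

open MvPolynomial

theorem aux_monomial_in_ideal (n : ℕ) (hn : 3 ≤ n) (k : ℕ) (hk2 : 2 ≤ k)
    (hkn : k ≤ n - 1) :
    (∏ i : Fin n, (X i : MvPolynomial (Fin n) ℝ) ^
        (if i.val + 1 = k then 2 * k - 1
         else if k < i.val + 1 then 2 * (i.val + 1) - 3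
         else 0)) ∈ sqSymIdealD n := by
  obtain ⟨c, rfl⟩ : ∃ c, k = c + 1 := ⟨k - 1, by omega⟩
  set x : ℕ → MvPolynomial (Fin n) ℝ := fun i => if h : i < n then X ⟨i, h⟩ else 0 with hx
  have hxi : ∀ i : Fin n, X i = x i.val := fun i => by simp [hx]
  set w := ∏ i ∈ Finset.Ico c n, x i with hw
  let I : Ideal (MvPolynomial (Fin n) ℝ) :=
    Submodule.comap (LinearMap.mulLeft (MvPolynomial (Fin n) ℝ) w) (sqSymIdealD n)
  have hI : ∀ p, p ∈ I ↔ w * p ∈ sqSymIdealD n := fun p => Iff.rfl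
  have h1 := prod_eq_X_pow n I (fun j hj => (hI _).2
    (Ideal.mul_mem_left _ _ (Ideal.subset_span (Or.inl ⟨j, hj, rfl⟩))))
  simp only [hxi] at h1
  rw [Fin.prod_univ_eq_prod_range (fun i => (Polynomial.X : Polynomial (MvPolynomial (Fin n) ℝ ⧸ I)) -
      Polynomial.C (Ideal.Quotient.mk I (x i ^ 2))) n] at h1
  have hp : ∏ i ∈ Finset.range n, x i ∈ sqSymIdealD n := by
    rw [← Fin.prod_univ_eq_prod_range]
    simp only [← hxi]
    exact Ideal.subset_span (Or.inr rfl)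
  have h0 : ∏ i ∈ Finset.range c, Ideal.Quotient.mk I (x i ^ 2) = 0 := by
    rw [← map_prod, Ideal.Quotient.eq_zero_iff_mem, hI]
    have : w * ∏ i ∈ Finset.range c, x i ^ 2
        = (∏ i ∈ Finset.range c, x i) * ∏ i ∈ Finset.range n, x i := by
      rw [← Finset.prod_range_mul_prod_Ico _ (show c ≤ n by omega), Finset.prod_pow]
      ring
    rw [this]
    exact Ideal.mul_mem_left _ _ hp
  have h2 := mono_zero n c (by omega) (by omega) (fun i => Ideal.Quotient.mk I (x i ^ 2)) h1 h0
  simp only [← map_pow] at h2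
  rw [← map_prod, Ideal.Quotient.eq_zero_iff_mem, hI, hw, ← Finset.prod_mul_distrib] at h2
  convert h2 using 1
  simp only [hxi]
  rw [Fin.prod_univ_eq_prod_range (fun i => x i ^ (if i + 1 = c + 1 then 2 * (c + 1) - 1
         else if c + 1 < i + 1 then 2 * (i + 1) - 3 else 0)) n,
    ← Finset.prod_range_mul_prod_Ico _ (show c ≤ n by omega), Finset.prod_eq_one, one_mul]
  · refine Finset.prod_congr rfl fun i hi => ?_
    have := Finset.mem_Ico.1 hi
    rw [← pow_mul, ← pow_succ']
    congr 1
    split_ifs <;> omega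
  · intro i hi
    have := Finset.mem_range.1 hi
    rw [if_neg (by omega), if_neg (by omega), pow_zero]
end

section
/- For every n ≥ 2, the images under the quotient map ℝ[x₁,…,xₙ] → ℝ[x₁,…,xₙ]/K of the monomials x₁^{α₁} x₂^{α₂} ⋯ xₙ^{αₙ} satisfying: 0 ≤ αᵢ ≤ 2i−1 for 1 ≤ i ≤ n−1, 0 ≤ αₙ ≤ 2n−2, and whenever αᵢ = 2i−1 for some i < n then α_j = 0 for at least one j with i < j ≤ n (i.e. the product α_{i+1}⋯αₙ = 0), form a basis of the quotient ring as a real vector space. -/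
open MvPolynomial

/-- The admissible exponent sequences for the basis of `ℝ[x₁,…,xₙ]/K`:
writing `αᵢ` for the exponent of `x_i = X ⟨i-1⟩`, we require `αᵢ ≤ 2i - 1` for
`i < n`, `αₙ ≤ 2n - 2`, and whenever `αᵢ = 2i - 1` for some `i < n` then
`α_j = 0` for some `j > i`.  In terms of indices `i : Fin n` (with
`x_{i.val+1} = X i`), the conditions read as below. -/
def AdmissibleExp (n : ℕ) (α : Fin n → ℕ) : Prop :=
  (∀ i : Fin n, i.val + 1 < n → α i ≤ 2 * i.val + 1) ∧
  (∀ i : Fin n, i.val + 1 = n → α i ≤ 2 * n - 2) ∧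
  (∀ i : Fin n, i.val + 1 < n → α i = 2 * i.val + 1 →
    ∃ j : Fin n, i < j ∧ α j = 0)


theorem exists_split_aux : ∀ (n : ℕ) (A : Type) [CommRing A] [Nontrivial A] (f : Polynomial A),
    f.Monic → f.natDegree = n →
    ∃ (B : Type) (_ : CommRing B) (_ : Algebra A B), Nontrivial B ∧ Module.Finite A B ∧
      Module.Free A B ∧ Module.finrank A B = 2 ^ n * n.factorial ∧
      ∃ x : Fin n → B, f.map (algebraMap A B) = ∏ i, (Polynomial.X - Polynomial.C (x i ^ 2)) ∧
        Algebra.adjoin A (Set.range x) = ⊤ := by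
  intro n
  induction n with
  | zero =>
    intro A _ _ f hf hd
    refine ⟨A, inferInstance, inferInstance, inferInstance, inferInstance, inferInstance, by simp,
      fun i => i.elim0, ?_, ?_⟩
    · rw [hf.natDegree_eq_zero.mp hd]; simp
    · rw [eq_top_iff]
      intro a _
      exact Subalgebra.algebraMap_mem _ a
  | succ n ih =>
    intro A _ _ f hf hd
    set g : Polynomial A := Polynomial.expand A 2 f with hg
    have hgm : g.Monic := hf.expand (by norm_num)
    have hgd : g.natDegree = 2 * (n + 1) := by
      rw [hg, Polynomial.natDegree_expand, hd, mul_comm]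
    let A₁ := AdjoinRoot g
    have hfin : Module.Finite A A₁ := hgm.finite_adjoinRoot
    have hfree : Module.Free A A₁ := hgm.free_adjoinRoot
    have hrk : Module.finrank A A₁ = 2 * (n + 1) := by
      rw [PowerBasis.finrank (AdjoinRoot.powerBasis' hgm)]
      simpa using hgd
    have hnt : Nontrivial A₁ := by
      by_contra h
      rw [not_nontrivial_iff_subsingleton] at h
      have := Module.finrank_zero_of_subsingleton (R := A) (M := A₁)
      omega
    let r : A₁ := AdjoinRoot.root g
    have hroot : (f.map (algebraMap A A₁)).IsRoot (r ^ 2) := by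
      have h1 : Polynomial.aeval r g = 0 := by
        simp [r, A₁, AdjoinRoot.aeval_eq]
      have h2 : Polynomial.aeval r (Polynomial.expand A 2 f) = 0 := h1
      rw [Polynomial.expand_aeval] at h2
      rw [Polynomial.IsRoot, Polynomial.eval_map_algebraMap]
      exact h2
    set f₁ := f.map (algebraMap A A₁) with hf₁
    have hf₁m : f₁.Monic := hf.map _
    have hf₁d : f₁.natDegree = n + 1 := by rw [hf₁, hf.natDegree_map, hd]
    let q := f₁ /ₘ (Polynomial.X - Polynomial.C (r ^ 2))
    have hq : (Polynomial.X - Polynomial.C (r ^ 2)) * q = f₁ :=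
      Polynomial.mul_divByMonic_eq_iff_isRoot.mpr hroot
    have hqm : q.Monic := by
      apply (Polynomial.monic_X_sub_C (r ^ 2)).of_mul_monic_left
      rw [hq]; exact hf₁m
    have hqd : q.natDegree = n := by
      have := (Polynomial.monic_X_sub_C (r ^ 2)).natDegree_mul hqm
      rw [hq, hf₁d, Polynomial.natDegree_X_sub_C] at this
      omega
    obtain ⟨B, iB, iAB, hBn, hBfin, hBfree, hBrk, x, hx, hadj⟩ := ih A₁ q hqm hqd
    let _ : Algebra A B := ((algebraMap A₁ B).comp (algebraMap A A₁)).toAlgebra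
    have _ : IsScalarTower A A₁ B := IsScalarTower.of_algebraMap_eq' rfl
    refine ⟨B, iB, inferInstance, hBn, Module.Finite.trans A₁ B, Module.Free.trans (S := A₁), ?_,
      Fin.cons (algebraMap A₁ B r) x, ?_, ?_⟩
    · rw [← Module.finrank_mul_finrank A A₁ B, hrk, hBrk, Nat.factorial_succ]
      ring
    · rw [Fin.prod_univ_succ]
      simp only [Fin.cons_zero, Fin.cons_succ]
      rw [← hx, IsScalarTower.algebraMap_eq A A₁ B, ← Polynomial.map_map, ← hf₁, ← hq]
      simp
    · set S := Algebra.adjoin A (Set.range (Fin.cons (algebraMap A₁ B r) x : Fin (n + 1) → B))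
      have hr : algebraMap A₁ B r ∈ S := Algebra.subset_adjoin ⟨0, rfl⟩
      have hA : ∀ a : A₁, algebraMap A₁ B a ∈ S := by
        intro a
        have ha : a ∈ Algebra.adjoin A {r} := by
          rw [AdjoinRoot.adjoinRoot_eq_top]; trivial
        induction ha using Algebra.adjoin_induction with
        | mem y hy => rw [Set.mem_singleton_iff] at hy; rwa [hy]
        | algebraMap c =>
          rw [← IsScalarTower.algebraMap_apply]; exact S.algebraMap_mem c
        | add y z _ _ h1 h2 => rw [map_add]; exact S.add_mem h1 h2
        | mul y z _ _ h1 h2 => rw [map_mul]; exact S.mul_mem h1 h2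
      rw [eq_top_iff]
      intro b _
      have hb : b ∈ Algebra.adjoin A₁ (Set.range x) := by rw [hadj]; trivial
      induction hb using Algebra.adjoin_induction with
      | mem y hy =>
        obtain ⟨i, rfl⟩ := hy
        exact Algebra.subset_adjoin ⟨i.succ, by simp⟩
      | algebraMap c => exact hA c
      | add y z _ _ h1 h2 => exact S.add_mem (h1 trivial) (h2 trivial)
      | mul y z _ _ h1 h2 => exact S.mul_mem (h1 trivial) (h2 trivial)

theorem esymm_card_aux {R : Type*} [CommRing R] (s : Multiset R) :
    s.esymm s.card = s.prod := by
  simp [Multiset.esymm]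

theorem exists_B (n : ℕ) (hn : 1 ≤ n) :
    ∃ (B : Type) (_ : CommRing B) (_ : Algebra ℝ B), Module.Finite ℝ B ∧
      Module.finrank ℝ B = 2 ^ n * n.factorial ∧
      ∃ x : Fin n → B, Function.Surjective (aeval x : MvPolynomial (Fin n) ℝ →ₐ[ℝ] B) ∧
        (∀ j ∈ Set.Icc 1 n, aeval (fun i => x i ^ 2) (esymm (Fin n) ℝ j) = 0) ∧
        (∏ i, x i) * (∏ i, x i) = 0 := by
  obtain ⟨B, iB, iAB, hBn, hBfin, hBfree, hBrk, x, hx, hadj⟩ :=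
    exists_split_aux n ℝ (Polynomial.X ^ n) (Polynomial.monic_X_pow n) (by simp)
  have hE : ∀ j ∈ Set.Icc 1 n,
      ((Finset.univ.val.map (fun i => x i ^ 2) : Multiset B)).esymm j = 0 := by
    intro j hj
    have h1 : (Multiset.map (fun t => Polynomial.X - Polynomial.C t)
        (Finset.univ.val.map (fun i => x i ^ 2))).prod = (Polynomial.X ^ n : Polynomial B) := by
      rw [Multiset.map_map]
      rw [Polynomial.map_pow, Polynomial.map_X] at hx
      exact hx.symm
    have h2 := Multiset.prod_X_sub_C_coeff (Finset.univ.val.map (fun i => x i ^ 2)) (k := n - j)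
      (by simp)
    rw [h1, Polynomial.coeff_X_pow, if_neg (by have := hj.1; have := hj.2; omega)] at h2
    have h3 : n - (n - j) = j := by have := hj.2; omega
    simp only [Multiset.card_map, Finset.card_val, Finset.card_univ, Fintype.card_fin, h3] at h2
    have h4 : ((-1 : B) ^ j) * (-1) ^ j = 1 := by rw [← mul_pow]; simp
    calc _ = ((-1 : B) ^ j * (-1) ^ j) * (Multiset.map (fun i => x i ^ 2) Finset.univ.val).esymm j := by
            rw [h4, one_mul]
      _ = 0 := by rw [mul_assoc, ← h2, mul_zero]
  refine ⟨B, iB, iAB, hBfin, hBrk, x, ?_, ?_, ?_⟩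
  · rw [← AlgHom.range_eq_top, ← Algebra.adjoin_range_eq_range_aeval, hadj]
  · intro j hj
    rw [aeval_esymm_eq_multiset_esymm]
    exact hE j hj
  · have h := hE n ⟨hn, le_rfl⟩
    have h2 := esymm_card_aux (Finset.univ.val.map (fun i => x i ^ 2) : Multiset B)
    simp only [Multiset.card_map, Finset.card_val, Finset.card_univ, Fintype.card_fin] at h2
    rw [h2] at h
    rw [← Finset.prod_mul_distrib]
    simp only [← sq]
    exact h


/-- Uniform version of admissibility. -/
def GoodExp (n : ℕ) (α : Fin n → ℕ) : Prop :=
  ∀ i : Fin n, α i ≤ 2 * i.val + 1 ∧ (α i = 2 * i.val + 1 → ∃ j : Fin n, i < j ∧ α j = 0)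

/-- The box of exponents. -/
def BoxExp (n : ℕ) : Type := (i : Fin n) → Fin (2 * i.val + 2)

noncomputable instance (n : ℕ) : Fintype (BoxExp n) := by unfold BoxExp; infer_instance

theorem card_box (n : ℕ) : Fintype.card (BoxExp n) = 2 ^ n * n.factorial := by
  have : Fintype.card (BoxExp n) = ∏ i : Fin n, (2 * i.val + 2) := by
    have h := Fintype.card_pi (ι := Fin n) (α := fun i => Fin (2 * i.val + 2))
    simp only [Fintype.card_fin] at h
    rw [← h]
    exact Fintype.card_congr (Equiv.refl _)
  rw [this]
  clear this
  induction n with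
  | zero => simp
  | succ n ih =>
    rw [Fin.prod_univ_castSucc]
    simp only [Fin.val_castSucc, Fin.val_last]
    rw [ih, Nat.factorial_succ]
    ring

theorem good_finite (n : ℕ) : Finite {α : Fin n → ℕ // GoodExp n α} := by
  refine Finite.of_injective (β := BoxExp n)
    (fun α i => ⟨α.1 i, by have := (α.2 i).1; omega⟩) ?_
  intro α β h
  ext i
  have := congrFun h i
  simpa using this

theorem card_good : ∀ n : ℕ, 
    2 * Nat.card {α : Fin (n + 1) → ℕ // GoodExp (n + 1) α} ≤ 2 ^ (n + 1) * (n + 1).factorial := by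
  have key : ∀ n, Nat.card {α : Fin (n + 1) → ℕ // GoodExp (n + 1) α} ≤
      2 ^ n * n.factorial + 2 * n * Nat.card {α : Fin n → ℕ // GoodExp n α} := by
    intro n
    classical
    have := good_finite n
    have hc : Nat.card (BoxExp n ⊕ (Fin (2 * n) × {α : Fin n → ℕ // GoodExp n α})) =
        2 ^ n * n.factorial + 2 * n * Nat.card {α : Fin n → ℕ // GoodExp n α} := by
      rw [Nat.card_sum, Nat.card_prod, Nat.card_eq_fintype_card, card_box]
      simp
    rw [← hc]
    have hlast : ∀ α : {α : Fin (n + 1) → ℕ // GoodExp (n + 1) α}, α.1 (Fin.last n) ≤ 2 * n := by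
      intro α
      obtain ⟨h1, h2⟩ := α.2 (Fin.last n)
      simp only [Fin.val_last] at h1 h2
      by_contra h
      obtain ⟨j, hj, _⟩ := h2 (by omega)
      exact absurd hj (not_lt.mpr (Fin.le_last j))
    refine Nat.card_le_card_of_injective (fun α : {α : Fin (n + 1) → ℕ // GoodExp (n + 1) α} =>
      if h : α.1 (Fin.last n) = 0 then
        Sum.inl (fun i => ⟨α.1 i.castSucc, by have := (α.2 i.castSucc).1; simp at this; omega⟩)
      else Sum.inr (⟨α.1 (Fin.last n) - 1, by have := hlast α; omega⟩,
        ⟨fun i => α.1 i.castSucc, by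
          intro i
          refine ⟨by have := (α.2 i.castSucc).1; simpa using this, fun hi => ?_⟩
          obtain ⟨j, hj, hj0⟩ := (α.2 i.castSucc).2 (by simpa using hi)
          rcases Fin.eq_castSucc_or_eq_last j with ⟨k, rfl⟩ | rfl
          · exact ⟨k, by simpa using hj, hj0⟩
          · exact absurd hj0 h⟩)) ?_
    intro α β hab
    have hgoal : α.1 (Fin.last n) = β.1 (Fin.last n) ∧
        ∀ i : Fin n, α.1 i.castSucc = β.1 i.castSucc := by
      by_cases h1 : α.1 (Fin.last n) = 0 <;> by_cases h2 : β.1 (Fin.last n) = 0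
      · simp only [h1, h2, dite_true] at hab
        have hab := Sum.inl.inj hab
        refine ⟨by rw [h1, h2], fun i => ?_⟩
        simpa using congrFun hab i
      · simp [h1, h2] at hab
      · simp [h1, h2] at hab
      · simp only [h1, h2, dite_false, Sum.inr.injEq, Prod.mk.injEq, Fin.mk.injEq] at hab
        have h3 := congrArg Subtype.val hab.2
        exact ⟨by omega, fun i => congrFun h3 i⟩
    apply Subtype.ext
    funext i
    rcases Fin.eq_castSucc_or_eq_last i with ⟨k, rfl⟩ | rfl
    · exact hgoal.2 k
    · exact hgoal.1
  intro n
  induction n with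
  | zero => have := key 0; simp at this ⊢; omega
  | succ n ih =>
    have h := key (n + 1)
    calc 2 * Nat.card {α : Fin (n + 1 + 1) → ℕ // GoodExp (n + 1 + 1) α}
        ≤ 2 * (2 ^ (n + 1) * (n + 1).factorial) +
          2 * (n + 1) * (2 * Nat.card {α : Fin (n + 1) → ℕ // GoodExp (n + 1) α}) := by
          calc _ ≤ 2 * _ := Nat.mul_le_mul_left 2 h
            _ = _ := by ring
      _ ≤ 2 * (2 ^ (n + 1) * (n + 1).factorial) +
          2 * (n + 1) * (2 ^ (n + 1) * (n + 1).factorial) := by gcongr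
      _ = _ := by rw [Nat.factorial_succ (n + 1)]; ring

/-- The variables indexed by naturals. -/
noncomputable def xv (n i : ℕ) : MvPolynomial (Fin n) ℝ :=
  if h : i < n then X ⟨i, h⟩ else 0

/-- Complete symmetric polynomials in the squares of the last `m` variables. -/
noncomputable def Hp (n : ℕ) : ℕ → ℕ → MvPolynomial (Fin n) ℝ
  | 0, 0 => 1
  | 0, _ + 1 => 0
  | _ + 1, 0 => 1
  | m + 1, k + 1 => Hp n m (k + 1) + xv n (n - (m + 1)) ^ 2 * Hp n (m + 1) k

/-- Signed elementary symmetric polynomials in the squares of the first `i` variables. -/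
noncomputable def Ep (n i k : ℕ) : MvPolynomial (Fin n) ℝ :=
  (-1) ^ k * ((Multiset.range i).map (fun j => xv n j ^ 2)).esymm k

theorem Hp_zero (n m : ℕ) : Hp n m 0 = 1 := by cases m <;> simp [Hp]

theorem Ep_zero (n i : ℕ) : Ep n i 0 = 1 := by simp [Ep, Multiset.esymm]

theorem Ep_succ (n i k : ℕ) :
    Ep n (i + 1) (k + 1) = Ep n i (k + 1) - xv n i ^ 2 * Ep n i k := by
  have : ((Multiset.range (i + 1)).map (fun j => xv n j ^ 2)).esymm (k + 1) =
      ((Multiset.range i).map (fun j => xv n j ^ 2)).esymm (k + 1) +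
      xv n i ^ 2 * ((Multiset.range i).map (fun j => xv n j ^ 2)).esymm k := by
    simp only [Multiset.esymm, Multiset.range_succ, Multiset.map_cons, Multiset.powersetCard_cons,
      Multiset.map_add, Multiset.sum_add, Multiset.map_map, Function.comp_def, Multiset.prod_cons,
      Multiset.sum_map_mul_left]
  rw [Ep, this, Ep, Ep, pow_succ]
  ring

theorem xv_val (n : ℕ) (i : Fin n) : xv n i.val = X i := by simp [xv]

theorem range_xv (n : ℕ) : (Multiset.range n).map (fun j => xv n j ^ 2) =
    Finset.univ.val.map (fun i : Fin n => (X i : MvPolynomial (Fin n) ℝ) ^ 2) := by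
  have h : Multiset.range n = (Finset.univ.val.map (fun i : Fin n => i.val)) := by
    have := congrArg Finset.val (Fin.map_valEmbedding_univ (n := n))
    rw [Nat.Iio_eq_range] at this
    exact this.symm
  rw [h, Multiset.map_map]
  simp only [Function.comp_def, xv_val]

theorem Ep_gt (n i k : ℕ) (h : i < k) : Ep n i k = 0 := by
  rw [Ep, Multiset.esymm, Multiset.powersetCard_eq_empty]
  · simp
  · simpa using h

theorem Ep_mem (n k : ℕ) : Ep n n (k + 1) ∈ sqSymIdealD n := by
  by_cases h : n < k + 1
  · rw [Ep_gt n n _ h]; exact Ideal.zero_mem _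
  · rw [Ep, range_xv, ← aeval_esymm_eq_multiset_esymm (Fin n) ℝ]
    apply Ideal.mul_mem_left
    apply Ideal.subset_span
    left
    exact ⟨k + 1, ⟨by omega, by omega⟩, rfl⟩

theorem Hp_sub_Ep (n : ℕ) : ∀ m ≤ n, ∀ k, Hp n m k - Ep n (n - m) k ∈ sqSymIdealD n := by
  intro m
  induction m with
  | zero =>
    intro _ k
    cases k with
    | zero => rw [Hp_zero, Ep_zero, sub_self]; exact Ideal.zero_mem _
    | succ k =>
      have := (sqSymIdealD n).neg_mem (Ep_mem n k)
      simpa [Hp] using this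
  | succ m ihm =>
    intro hm k
    induction k with
    | zero => rw [Hp_zero, Ep_zero, sub_self]; exact Ideal.zero_mem _
    | succ k ihk =>
      have h1 := ihm (by omega) (k + 1)
      have h2 := Ideal.mul_mem_left _ (xv n (n - (m + 1)) ^ 2) ihk
      have h3 := Ep_succ n (n - (m + 1)) k
      rw [show n - (m + 1) + 1 = n - m by omega] at h3
      rw [h3] at h1
      have h4 := Ideal.add_mem _ h1 h2
      rw [Hp]
      convert h4 using 1
      ring

theorem Hp_degree (n : ℕ) : ∀ m (hm : m + 1 ≤ n) (k : ℕ),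
    MonomialOrder.lex.Monic (Hp n (m + 1) k) ∧
    MonomialOrder.lex.degree (Hp n (m + 1) k) =
      Finsupp.single (⟨n - (m + 1), by omega⟩ : Fin n) (2 * k) := by
  intro m
  induction m with
  | zero =>
    intro hm k
    induction k with
    | zero => rw [Hp_zero]; simp [MonomialOrder.monic_one]
    | succ k ihk =>
      have hx : xv n (n - (0 + 1)) = X (⟨n - (0 + 1), by omega⟩ : Fin n) := by
        rw [xv, dif_pos]
      rw [Hp, Hp, zero_add, hx]
      have hXm : MonomialOrder.lex.Monic ((X (⟨n - (0 + 1), by omega⟩ : Fin n) :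
        MvPolynomial (Fin n) ℝ) ^ 2) := MonomialOrder.monic_X.pow
      refine ⟨hXm.mul ihk.1, ?_⟩
      rw [MonomialOrder.degree_mul hXm.ne_zero ihk.1.ne_zero, ihk.2, MonomialOrder.degree_pow,
        MonomialOrder.degree_X, Finsupp.smul_single, ← Finsupp.single_add]
      congr 1
      simp; ring
  | succ m ihm =>
    intro hm k
    induction k with
    | zero => rw [Hp_zero]; simp [MonomialOrder.monic_one]
    | succ k ihk =>
      have hx : xv n (n - (m + 1 + 1)) = X (⟨n - (m + 1 + 1), by omega⟩ : Fin n) := by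
        rw [xv, dif_pos]
      rw [Hp, hx]
      have hXm : MonomialOrder.lex.Monic ((X (⟨n - (m + 1 + 1), by omega⟩ : Fin n) :
        MvPolynomial (Fin n) ℝ) ^ 2) := MonomialOrder.monic_X.pow
      have hM := hXm.mul ihk.1
      have hD : MonomialOrder.lex.degree ((X (⟨n - (m + 1 + 1), by omega⟩ : Fin n) :
          MvPolynomial (Fin n) ℝ) ^ 2 * Hp n (m + 1 + 1) k) =
          Finsupp.single (⟨n - (m + 1 + 1), by omega⟩ : Fin n) (2 * (k + 1)) := by
        rw [MonomialOrder.degree_mul hXm.ne_zero ihk.1.ne_zero, ihk.2, MonomialOrder.degree_pow,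
          MonomialOrder.degree_X, Finsupp.smul_single, ← Finsupp.single_add]
        congr 1
        simp; ring
      obtain ⟨h1, h2⟩ := ihm (by omega) (k + 1)
      have hlt : MonomialOrder.lex.toSyn (MonomialOrder.lex.degree (Hp n (m + 1) (k + 1))) <
          MonomialOrder.lex.toSyn (MonomialOrder.lex.degree
          ((X (⟨n - (m + 1 + 1), by omega⟩ : Fin n) :
          MvPolynomial (Fin n) ℝ) ^ 2 * Hp n (m + 1 + 1) k)) := by
        rw [hD, h2, MonomialOrder.lex_lt_iff, Finsupp.Lex.lt_iff]
        refine ⟨⟨n - (m + 1 + 1), by omega⟩, ?_, ?_⟩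
        · intro j hj
          have hj' : j.val < n - (m + 1 + 1) := hj
          have e1 : (⟨n - (m + 1), by omega⟩ : Fin n) ≠ j := by
            intro h; rw [← h] at hj'; simp at hj'; omega
          have e2 : (⟨n - (m + 1 + 1), by omega⟩ : Fin n) ≠ j := by
            intro h; rw [← h] at hj'; simp at hj'
          simp [Finsupp.single_apply, e1, e2]
        · have e1 : (⟨n - (m + 1), by omega⟩ : Fin n) ≠ ⟨n - (m + 1 + 1), by omega⟩ := by
            intro h; simp at h; omega
          simp [Finsupp.single_apply, e1]
      rw [add_comm]
      exact ⟨hM.add_of_lt hlt, by rw [MonomialOrder.degree_add_of_lt hlt, hD]⟩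

/-- Leading-term generators. -/
noncomputable def Gp (n : ℕ) : Fin n ⊕ Fin n → MvPolynomial (Fin n) ℝ
  | .inl i => Hp n (n - i.val) (i.val + 1)
  | .inr i => (∏ j ∈ Finset.univ.filter (fun j => i ≤ j), X j) * Hp n (n - i.val) i.val

theorem Hp_degree' (n : ℕ) (i : Fin n) (k : ℕ) :
    MonomialOrder.lex.Monic (Hp n (n - i.val) k) ∧
    MonomialOrder.lex.degree (Hp n (n - i.val) k) = Finsupp.single i (2 * k) := by
  have h := Hp_degree n (n - i.val - 1) (by omega) k
  have e : n - i.val - 1 + 1 = n - i.val := by omega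
  have e2 : (⟨n - (n - i.val - 1 + 1), by omega⟩ : Fin n) = i := by
    apply Fin.ext; simp only; omega
  rw [e2, e] at h
  exact h

theorem prodX_degree (n : ℕ) (s : Finset (Fin n)) :
    MonomialOrder.lex.Monic (∏ j ∈ s, (X j : MvPolynomial (Fin n) ℝ)) ∧
    MonomialOrder.lex.degree (∏ j ∈ s, (X j : MvPolynomial (Fin n) ℝ)) =
      ∑ j ∈ s, Finsupp.single j 1 := by
  refine ⟨MonomialOrder.Monic.prod (fun _ _ => MonomialOrder.monic_X), ?_⟩
  rw [MonomialOrder.degree_prod (fun i _ => X_ne_zero i)]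
  simp [MonomialOrder.degree_X]

theorem Gp_monic (n : ℕ) (t : Fin n ⊕ Fin n) : MonomialOrder.lex.Monic (Gp n t) := by
  rcases t with i | i
  · exact (Hp_degree' n i _).1
  · exact (prodX_degree n _).1.mul (Hp_degree' n i _).1

theorem prod_lt (n : ℕ) (i : Fin n) : ∏ j ∈ Finset.range i.val, xv n j =
    ∏ j ∈ Finset.univ.filter (fun j : Fin n => ¬ i ≤ j), (X j : MvPolynomial (Fin n) ℝ) := by
  rw [Finset.prod_filter]
  have : ∀ j : Fin n, (if ¬ i ≤ j then (X j : MvPolynomial (Fin n) ℝ) else 1) =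
      (fun j : ℕ => if j < i.val then xv n j else 1) j.val := by
    intro j
    simp only [xv_val, not_le, Fin.lt_def]
  rw [Finset.prod_congr rfl (fun j _ => this j),
    Fin.prod_univ_eq_prod_range (fun j : ℕ => if j < i.val then xv n j else 1) n,
    ← Finset.prod_filter]
  apply Finset.prod_congr _ (fun _ _ => rfl)
  ext j
  have := i.isLt
  simp only [Finset.mem_range, Finset.mem_filter]
  omega

theorem Gp_mem (n : ℕ) (t : Fin n ⊕ Fin n) : Gp n t ∈ sqSymIdealD n := by
  rcases t with i | i
  · have h := Hp_sub_Ep n (n - i.val) (by omega) (i.val + 1)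
    have e : n - (n - i.val) = i.val := by omega
    rw [e, Ep_gt n _ _ (by omega), sub_zero] at h
    exact h
  · have h := Hp_sub_Ep n (n - i.val) (by omega) i.val
    have e : n - (n - i.val) = i.val := by omega
    rw [e] at h
    have h2 := Ideal.mul_mem_left _ (∏ j ∈ Finset.univ.filter (fun j => i ≤ j), X j) h
    rw [mul_sub] at h2
    refine (Submodule.sub_mem_iff_left _ ?_).mp h2
    have h3 := esymm_card_aux ((Multiset.range i.val).map (fun j => xv n j ^ 2))
    rw [Multiset.card_map, Multiset.card_range] at h3
    have h4 : ((Multiset.range i.val).map (fun j => xv n j ^ 2)).prod =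
      (∏ j ∈ Finset.range i.val, xv n j) ^ 2 := by
      rw [← Finset.prod_pow]; rfl
    rw [Ep, h3, h4, prod_lt]
    have h5 := Finset.prod_filter_mul_prod_filter_not Finset.univ (fun j : Fin n => i ≤ j)
      (fun j => (X j : MvPolynomial (Fin n) ℝ))
    have h6 : ∏ j : Fin n, (X j : MvPolynomial (Fin n) ℝ) ∈ sqSymIdealD n :=
      Ideal.subset_span (Or.inr rfl)
    rw [← h5] at h6
    have h7 := Ideal.mul_mem_left _ ((-1) ^ i.val *
      ∏ j ∈ Finset.univ.filter (fun j : Fin n => ¬ i ≤ j), (X j : MvPolynomial (Fin n) ℝ)) h6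
    convert h7 using 1
    ring

theorem good_of_not_le (n : ℕ) (c : Fin n →₀ ℕ)
    (h : ∀ t, ¬ (MonomialOrder.lex.degree (Gp n t) ≤ c)) : GoodExp n c := by
  intro i
  have h1 := h (.inl i)
  rw [Gp, (Hp_degree' n i _).2, Finsupp.single_le_iff] at h1
  refine ⟨by omega, fun hi => ?_⟩
  by_contra! hne
  apply h (.inr i)
  rw [Gp, MonomialOrder.degree_mul (prodX_degree n _).1.ne_zero (Hp_degree' n i _).1.ne_zero,
    (Hp_degree' n i _).2, (prodX_degree n _).2]
  intro j
  simp only [Finsupp.add_apply, Finsupp.finsetSum_apply, Finsupp.single_apply,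
    Finset.sum_ite_eq', Finset.mem_filter, Finset.mem_univ, true_and]
  rcases lt_trichotomy i j with hij | rfl | hij
  · have := hne j hij
    rw [if_pos hij.le, if_neg hij.ne]; omega
  · simp; omega
  · rw [if_neg (not_le.mpr hij), if_neg hij.ne']; simp

theorem span_good (n : ℕ) : Submodule.span ℝ
      (Set.range (fun α : {α : Fin n → ℕ // GoodExp n α} =>
        Ideal.Quotient.mk (sqSymIdealD n)
          (∏ i : Fin n, (X i : MvPolynomial (Fin n) ℝ) ^ α.val i))) = ⊤ := by
  rw [eq_top_iff]
  intro q _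
  obtain ⟨f, rfl⟩ := Ideal.Quotient.mk_surjective q
  obtain ⟨g, r, hf, -, hr⟩ := MonomialOrder.lex.div (b := Gp n)
    (fun t => by rw [(Gp_monic n t).leadingCoeff_eq_one]; exact isUnit_one) f
  have h0 : Ideal.Quotient.mk (sqSymIdealD n) f = Ideal.Quotient.mk (sqSymIdealD n) r := by
    rw [Ideal.Quotient.mk_eq_mk_iff_sub_mem, hf, add_sub_cancel_right,
      Finsupp.linearCombination_apply]
    exact Submodule.sum_mem _ (fun t _ => Ideal.mul_mem_left _ _ (Gp_mem n t))
  rw [h0, r.as_sum, map_sum]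
  refine Submodule.sum_mem _ (fun c hc => ?_)
  have hg := good_of_not_le n c (hr c hc)
  have : Ideal.Quotient.mk (sqSymIdealD n) (monomial c (coeff c r)) =
      coeff c r • Ideal.Quotient.mk (sqSymIdealD n)
          (∏ i : Fin n, (X i : MvPolynomial (Fin n) ℝ) ^ c i) := by
    rw [monomial_eq, Finsupp.prod_fintype _ _ (by simp), ← MvPolynomial.smul_eq_C_mul]
    rfl
  rw [this]
  exact Submodule.smul_mem _ _ (Submodule.subset_span ⟨⟨c, hg⟩, rfl⟩)

theorem admissible_iff (n : ℕ) (α : Fin n → ℕ) : AdmissibleExp n α ↔ GoodExp n α := by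
  constructor
  · rintro ⟨h1, h2, h3⟩ i
    by_cases hi : i.val + 1 < n
    · exact ⟨h1 i hi, h3 i hi⟩
    · have := h2 i (by omega)
      exact ⟨by omega, fun h => by omega⟩
  · intro h
    refine ⟨fun i _ => (h i).1, fun i hi => ?_, fun i _ => (h i).2⟩
    obtain ⟨h1, h2⟩ := h i
    by_contra hc
    obtain ⟨j, hj, _⟩ := h2 (by omega)
    have := Fin.lt_def.mp hj
    omega

theorem indep_good (n : ℕ) (hn : 1 ≤ n) : LinearIndependent ℝ
      (fun α : {α : Fin n → ℕ // GoodExp n α} =>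
        Ideal.Quotient.mk (sqSymIdealD n)
          (∏ i : Fin n, (X i : MvPolynomial (Fin n) ℝ) ^ α.val i)) := by
  obtain ⟨B, iB, iAB, hBfin, hBrk, x, hsurj, hE, hp⟩ := exists_B n hn
  set p : B := ∏ i, x i with hpdef
  let φ : MvPolynomial (Fin n) ℝ →ₐ[ℝ] B := aeval x
  let μ : B →ₗ[ℝ] B := LinearMap.mulLeft ℝ p
  let P : Submodule ℝ B := LinearMap.range μ
  have hPk : P ≤ LinearMap.ker μ := by
    rintro _ ⟨b, rfl⟩
    rw [LinearMap.mem_ker]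
    simp only [μ, LinearMap.mulLeft_apply]
    rw [← mul_assoc, hp, zero_mul]
  have hdim : Module.finrank ℝ B ≤ 2 * Module.finrank ℝ (B ⧸ P) := by
    have h1 := Submodule.finrank_quotient_add_finrank P
    have h2 := LinearMap.finrank_range_add_finrank_ker μ
    have h3 := Submodule.finrank_mono hPk
    change Module.finrank ℝ P + _ = _ at h2
    omega
  let ψ : MvPolynomial (Fin n) ℝ →ₗ[ℝ] (B ⧸ P) := P.mkQ ∘ₗ φ.toLinearMap
  have hψ : Function.Surjective ψ := (Submodule.mkQ_surjective P).comp hsurj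
  have hK : (sqSymIdealD n).restrictScalars ℝ ≤ LinearMap.ker ψ := by
    have hK1 : sqSymIdealD n ≤ (Ideal.span {p}).comap φ.toRingHom := by
      rw [sqSymIdealD, Ideal.span_le]
      rintro q (⟨j, hj, rfl⟩ | hq)
      · have : φ (aeval (fun i => (X i : MvPolynomial (Fin n) ℝ) ^ 2) (esymm (Fin n) ℝ j)) = 0 := by
          rw [← AlgHom.comp_apply, comp_aeval]
          simpa [φ] using hE j hj
        change φ _ ∈ Ideal.span {p}
        rw [this]
        exact Ideal.zero_mem _
      · rw [Set.mem_singleton_iff] at hq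
        subst hq
        change φ _ ∈ Ideal.span {p}
        have : φ (∏ i, X i) = p := by simp [φ, hpdef]
        rw [this]
        exact Ideal.mem_span_singleton_self p
    intro a ha
    have h1 : φ a ∈ Ideal.span {p} := hK1 ha
    obtain ⟨b, hb⟩ := Ideal.mem_span_singleton'.mp h1
    rw [LinearMap.mem_ker]
    change P.mkQ (φ a) = 0
    rw [Submodule.mkQ_apply, Submodule.Quotient.mk_eq_zero]
    exact ⟨b, by simp only [μ, LinearMap.mulLeft_apply]; rw [mul_comm, hb]⟩
  let F : (MvPolynomial (Fin n) ℝ ⧸ sqSymIdealD n) →ₗ[ℝ] (B ⧸ P) :=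
    (((sqSymIdealD n).restrictScalars ℝ).liftQ ψ hK) ∘ₗ
      (Submodule.Quotient.restrictScalarsEquiv ℝ (sqSymIdealD n)).symm.toLinearMap
  have hF : ∀ a, F (Ideal.Quotient.mk (sqSymIdealD n) a) = ψ a := fun a => rfl
  have hFs : Function.Surjective F := by
    intro y
    obtain ⟨a, rfl⟩ := hψ y
    exact ⟨_, hF a⟩
  have := good_finite n
  have := Fintype.ofFinite {α : Fin n → ℕ // GoodExp n α}
  apply LinearIndependent.of_comp F
  have hspan := congrArg (Submodule.map F) (span_good n)
  rw [Submodule.map_span, Submodule.map_top, LinearMap.range_eq_top.mpr hFs, ← Set.range_comp]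
    at hspan
  apply linearIndependent_of_top_le_span_of_card_eq_finrank hspan.ge
  apply le_antisymm
  · obtain ⟨m, rfl⟩ : ∃ m, n = m + 1 := ⟨n - 1, by omega⟩
    have := card_good m
    rw [Nat.card_eq_fintype_card] at this
    omega
  · exact finrank_le_of_span_eq_top hspan

/-- The images in the quotient `ℝ[x₁,…,xₙ]/K` of the monomials
`x₁^{α₁} ⋯ xₙ^{αₙ}` with admissible exponents form a basis of the quotient as
a real vector space. -/
theorem basis_of_spin_quotient (n : ℕ) (hn : 2 ≤ n) :
    LinearIndependent ℝ
      (fun α : {α : Fin n → ℕ // AdmissibleExp n α} =>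
        Ideal.Quotient.mk (sqSymIdealD n)
          (∏ i : Fin n, (X i : MvPolynomial (Fin n) ℝ) ^ α.val i)) ∧
    Submodule.span ℝ
      (Set.range (fun α : {α : Fin n → ℕ // AdmissibleExp n α} =>
        Ideal.Quotient.mk (sqSymIdealD n)
          (∏ i : Fin n, (X i : MvPolynomial (Fin n) ℝ) ^ α.val i))) = ⊤ := by
  have hset : AdmissibleExp n = GoodExp n := funext fun α => propext (admissible_iff n α)
  rw [hset]
  exact ⟨indep_good n (by omega), span_good n⟩
end

section
/- For every n ≥ 2, the quotient ring ℝ[x₁,…,xₙ]/K is a finite-dimensional real vector space of dimension 2^{n−1} · n!. -/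
open MvPolynomial

namespace SpinQ

open Polynomial

lemma tower (n : ℕ) : ∀ (A : Type) [CommRing A] [Nontrivial A] (f : A[X]), f.Monic →
    f.natDegree = n →
    ∃ (E : Type) (_ : CommRing E) (_ : Algebra A E) (x : Fin n → E),
      Nonempty (Module.Basis (Fin (2 ^ n * n.factorial)) A E) ∧
      f.map (algebraMap A E) = ∏ i, (Polynomial.X - Polynomial.C (x i ^ 2)) ∧
      (∀ (S : Type) [CommRing S] (h : A →+* S) (y : Fin n → S),
        f.map h = ∏ i, (Polynomial.X - Polynomial.C (y i ^ 2)) →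
        ∃ φ : E →+* S, φ.comp (algebraMap A E) = h ∧ ∀ i, φ (x i) = y i) ∧
      (∀ (S : Type) [CommRing S] (φ ψ : E →+* S),
        φ.comp (algebraMap A E) = ψ.comp (algebraMap A E) → (∀ i, φ (x i) = ψ (x i)) → φ = ψ) := by
  induction n with
  | zero =>
    intro A _ _ f hf hd
    have hf1 : f = 1 := hf.natDegree_eq_zero.mp hd
    refine ⟨A, inferInstance, inferInstance, Fin.elim0, ⟨?_⟩, ?_, ?_, ?_⟩
    · exact (Module.Basis.singleton (Fin 1) A).reindex (finCongr (by simp))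
    · simp [hf1]
    · intro S _ h y _
      exact ⟨h, by ext; simp, fun i => i.elim0⟩
    · intro S _ φ ψ h _
      simpa using h
  | succ n ih =>
    intro A _ _ f hf hd
    set g := expand A 2 f with hg
    have hgm : g.Monic := hf.expand (by norm_num)
    have hgd : g.natDegree = (n + 1) * 2 := by rw [hg, natDegree_expand, hd]
    let pb := AdjoinRoot.powerBasis' hgm
    have hdim : pb.dim = (n + 1) * 2 := by rw [← hgd]; exact AdjoinRoot.powerBasis'_dim hgm
    have : Nontrivial (AdjoinRoot g) := by
      have : Nonempty (Fin pb.dim) := ⟨⟨0, by omega⟩⟩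
      exact pb.basis.repr.toEquiv.nontrivial
    set α := AdjoinRoot.root g with hα
    set F := f.map (AdjoinRoot.of g) with hF
    have hroot : F.IsRoot (α ^ 2) := by
      have key : ∀ (S : Type) [CommRing S] (k : A →+* S) (s : S),
          Polynomial.eval₂ k s g = Polynomial.eval₂ k (s ^ 2) f := by
        intro S _ k s
        rw [hg, expand_eq_comp_X_pow, Polynomial.eval₂_comp]
        simp
      rw [IsRoot, hF, Polynomial.eval_map, ← key]
      exact AdjoinRoot.eval₂_root g
    set f1 := F /ₘ (Polynomial.X - Polynomial.C (α ^ 2)) with hf1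
    have hmul : (Polynomial.X - Polynomial.C (α ^ 2)) * f1 = F := mul_divByMonic_eq_iff_isRoot.mpr hroot
    have hf1m : f1.Monic := by
      have h1 : F.Monic := hf.map _
      rw [← hmul] at h1
      exact (monic_X_sub_C _).of_mul_monic_left h1
    have hf1d : f1.natDegree = n := by
      rw [hf1, natDegree_divByMonic _ (monic_X_sub_C _), natDegree_X_sub_C, hF,
        hf.natDegree_map, hd]; rfl
    obtain ⟨E, _, _, x, ⟨b⟩, hx, hex, hun⟩ := ih (AdjoinRoot g) f1 hf1m hf1d
    let : Algebra A E := ((algebraMap (AdjoinRoot g) E).comp (AdjoinRoot.of g)).toAlgebra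
    have hAE : algebraMap A E = (algebraMap (AdjoinRoot g) E).comp (AdjoinRoot.of g) := rfl
    have : IsScalarTower A (AdjoinRoot g) E := IsScalarTower.of_algebraMap_eq (fun _ => rfl)
    refine ⟨E, inferInstance, inferInstance, Fin.cons (algebraMap _ E α) x, ⟨?_⟩, ?_, ?_, ?_⟩
    · refine (pb.basis.smulTower b).reindex (finProdFinEquiv.trans (finCongr ?_))
      rw [hdim, Nat.factorial_succ]; ring
    · rw [hAE, ← Polynomial.map_map, ← hF, ← hmul, Polynomial.map_mul, hx, Fin.prod_univ_succ]
      simp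
    · intro S _ h y hy
      have h0 : eval₂ h (y 0) g = 0 := by
        rw [hg, expand_eq_comp_X_pow, Polynomial.eval₂_comp, ← Polynomial.eval_map, hy, Fin.prod_univ_succ]
        simp
      let h1 := AdjoinRoot.lift h (y 0) h0
      have hh1 : h1.comp (AdjoinRoot.of g) = h := by ext; simp [h1]
      have hh1r : h1 α = y 0 := by simp [h1, hα]
      obtain ⟨φ, hφ, hφx⟩ := hex S h1 (fun i => y i.succ) (by
        rw [Fin.prod_univ_succ, ← hh1, ← Polynomial.map_map, ← hF, ← hmul] at hy
        apply (monic_X_sub_C (y 0 ^ 2)).isRegular.left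
        simp only
        rw [← hy]
        simp [hh1r])
      refine ⟨φ, ?_, ?_⟩
      · rw [hAE, ← RingHom.comp_assoc, hφ, hh1]
      · intro i
        refine Fin.cases ?_ ?_ i
        · rw [Fin.cons_zero, ← hh1r, ← hφ]; rfl
        · intro i; simpa using hφx i
    · intro S _ φ ψ h hxx
      apply hun
      · apply AdjoinRoot.ringHom_ext
        · rw [RingHom.comp_assoc, RingHom.comp_assoc, ← hAE, h]
        · simpa using hxx 0
      · intro i; simpa using hxx i.succ

lemma dimlem (E : Type) [CommRing E] [Algebra ℝ[X] E] [Algebra ℝ E] [IsScalarTower ℝ ℝ[X] E]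
    {N : ℕ} (b : Module.Basis (Fin N) ℝ[X] E) (p u : E) (hu : IsUnit u)
    (hp : algebraMap ℝ[X] E Polynomial.X = u * p ^ 2) :
    Module.Finite ℝ (E ⧸ Ideal.span {p}) ∧ 2 * Module.finrank ℝ (E ⧸ Ideal.span {p}) = N := by
  -- the coordinates at zero
  let ev : ℝ[X] →ₗ[ℝ] ℝ := (Polynomial.aeval (0 : ℝ)).toLinearMap
  let L : E →ₗ[ℝ] (Fin N → ℝ) :=
    (LinearMap.compLeft ev (Fin N)) ∘ₗ (b.equivFun.toLinearMap.restrictScalars ℝ)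
  have hL : ∀ e i, L e i = (b.equivFun e i).eval 0 := fun e i => by
    simp [L, ev, Polynomial.aeval_def, Polynomial.eval₂_eq_eval_map]
  have hLs : Function.Surjective L := by
    intro v
    refine ⟨b.equivFun.symm (fun i => Polynomial.C (v i)), ?_⟩
    ext i
    rw [hL, LinearEquiv.apply_symm_apply]; simp
  have hLk : ∀ e, L e = 0 ↔ p ^ 2 ∣ e := by
    intro e
    have h1 : p ^ 2 ∣ e ↔ algebraMap ℝ[X] E Polynomial.X ∣ e := by
      rw [hp]; exact (hu.mul_left_dvd).symm
    rw [h1]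
    constructor
    · intro h
      have : ∀ i, ∃ q, b.equivFun e i = Polynomial.X * q := by
        intro i
        have := congrFun h i
        rw [hL] at this
        exact Polynomial.X_dvd_iff.mpr (by rw [Polynomial.coeff_zero_eq_eval_zero]; simpa using this)
      choose q hq using this
      refine ⟨b.equivFun.symm q, ?_⟩
      apply b.equivFun.injective
      rw [← Algebra.smul_def, map_smul, LinearEquiv.apply_symm_apply]
      ext1 i
      simpa using hq i
    · rintro ⟨c, rfl⟩
      ext i
      rw [hL, ← Algebra.smul_def, map_smul]
      simp
  have hreg : ∀ e, p * e = 0 → e = 0 := by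
    intro e he
    have : (Polynomial.X : ℝ[X]) • e = 0 := by
      rw [Algebra.smul_def, hp]
      linear_combination u * p * he
    apply b.equivFun.injective
    have h2 := congrArg b.equivFun this
    rw [map_smul] at h2
    ext1 i
    have := congrFun h2 i
    simpa using this
  let I : Submodule ℝ E := (Ideal.span {p}).restrictScalars ℝ
  have hI : ∀ e, e ∈ I ↔ p ∣ e := fun e => by
    simp [I, Ideal.mem_span_singleton]
  let W : Submodule ℝ (Fin N → ℝ) := I.map L
  let M : E →ₗ[ℝ] (Fin N → ℝ) ⧸ W := W.mkQ ∘ₗ L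
  have hMs : Function.Surjective M := (Submodule.mkQ_surjective W).comp hLs
  have hMk : LinearMap.ker M = I := by
    ext e
    rw [LinearMap.mem_ker]
    simp only [M, LinearMap.comp_apply, Submodule.mkQ_apply, Submodule.Quotient.mk_eq_zero]
    constructor
    · rintro ⟨c, hc, hce⟩
      have : L (e - c) = 0 := by rw [map_sub, hce, sub_self]
      rw [hLk] at this
      rw [hI]
      have h2 : p ∣ e - c := (dvd_pow_self p two_ne_zero).trans this
      have h3 : p ∣ c := (hI c).mp hc
      simpa using dvd_add h2 h3
    · intro h; exact ⟨e, h, rfl⟩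
  let P : E →ₗ[ℝ] (Fin N → ℝ) := L ∘ₗ LinearMap.mulLeft ℝ p
  have hPr : LinearMap.range P = W := by
    ext v
    constructor
    · rintro ⟨e, rfl⟩
      exact ⟨p * e, (hI _).mpr ⟨e, rfl⟩, rfl⟩
    · rintro ⟨c, hc, rfl⟩
      obtain ⟨e, rfl⟩ := (hI _).mp hc
      exact ⟨e, rfl⟩
  have hPk : LinearMap.ker P = I := by
    ext e
    rw [LinearMap.mem_ker, hI]
    change L (p * e) = 0 ↔ _
    rw [hLk]
    constructor
    · rintro ⟨c, hc⟩
      refine ⟨c, sub_eq_zero.mp (hreg _ ?_)⟩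
      linear_combination hc
    · rintro ⟨c, rfl⟩
      exact ⟨c, by ring⟩
  let e1 : (E ⧸ I) ≃ₗ[ℝ] ((Fin N → ℝ) ⧸ W) :=
    (Submodule.quotEquivOfEq _ _ hMk.symm).trans (M.quotKerEquivOfSurjective hMs)
  let e2 : (E ⧸ I) ≃ₗ[ℝ] W :=
    (Submodule.quotEquivOfEq _ _ hPk.symm).trans (P.quotKerEquivRange.trans (LinearEquiv.ofEq _ _ hPr))
  let e3 : (E ⧸ I) ≃ₗ[ℝ] (E ⧸ Ideal.span {p}) :=
    Submodule.Quotient.restrictScalarsEquiv ℝ (Ideal.span {p})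
  have hsum := Submodule.finrank_quotient_add_finrank W
  rw [← e1.finrank_eq, ← e2.finrank_eq, e3.finrank_eq] at hsum
  refine ⟨Module.Finite.equiv (e2.symm.trans e3), ?_⟩
  rw [two_mul, hsum]; simp

lemma prod_coeff {S : Type} [CommRing S] [Algebra ℝ S] {n : ℕ} (y : Fin n → S) (j : ℕ) (hj : j ≤ n) :
    (∏ i, (Polynomial.X - Polynomial.C (y i ^ 2))).coeff (n - j) =
      (-1) ^ j * MvPolynomial.aeval (fun i => y i ^ 2) (MvPolynomial.esymm (Fin n) ℝ j) := by
  have := Multiset.prod_X_sub_C_coeff (Multiset.map (fun i => y i ^ 2) (Finset.univ : Finset (Fin n)).val)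
    (k := n - j) (by simp)
  rw [MvPolynomial.aeval_esymm_eq_multiset_esymm]
  simp only [Multiset.map_map, Multiset.card_map, Finset.card_val, Finset.card_univ,
    Fintype.card_fin] at this
  rw [Nat.sub_sub_self hj] at this
  rw [← this]
  rfl

lemma aeval_sq {S : Type} [CommRing S] [Algebra ℝ S] {n : ℕ} (y : Fin n → S)
    (q : MvPolynomial (Fin n) ℝ) :
    MvPolynomial.aeval y (MvPolynomial.aeval
      (fun i => (MvPolynomial.X i : MvPolynomial (Fin n) ℝ) ^ 2) q) =
    MvPolynomial.aeval (fun i => y i ^ 2) q := by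
  rw [← AlgHom.comp_apply]
  congr 1
  ext i
  simp

lemma main (n : ℕ) (hn : 1 ≤ n) :
    Module.Finite ℝ (MvPolynomial (Fin n) ℝ ⧸ sqSymIdealD n) ∧
    2 * Module.finrank ℝ (MvPolynomial (Fin n) ℝ ⧸ sqSymIdealD n) = 2 ^ n * n.factorial := by
  obtain ⟨E, _, _, x, ⟨b⟩, hx, hex, hun⟩ := tower n ℝ[X]
    (Polynomial.X ^ n - Polynomial.C Polynomial.X) (monic_X_pow_sub_C _ (by omega))
    (natDegree_X_pow_sub_C)
  let : Algebra ℝ E := ((algebraMap ℝ[X] E).comp (algebraMap ℝ ℝ[X])).toAlgebra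
  have : IsScalarTower ℝ ℝ[X] E := IsScalarTower.of_algebraMap_eq (fun _ => rfl)
  set p : E := ∏ i, x i with hp
  have hX : algebraMap ℝ[X] E Polynomial.X = (-1) ^ (n + 1) * p ^ 2 := by
    have := congrArg (Polynomial.eval 0) hx
    rw [Polynomial.eval_prod] at this
    simp [Finset.prod_neg, Finset.prod_pow, show n ≠ 0 by omega] at this
    linear_combination -this
  obtain ⟨hfin, hdim⟩ := dimlem E b p ((-1) ^ (n + 1)) (IsUnit.pow _ isUnit_one.neg) hX
  -- forward map
  have hK : ∀ q ∈ sqSymIdealD n,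
      ((Ideal.Quotient.mkₐ ℝ (Ideal.span {p})).comp (MvPolynomial.aeval x)) q = 0 := by
    intro q hq
    rw [← RingHom.mem_ker]
    refine (Ideal.span_le.mpr ?_ : sqSymIdealD n ≤ _) hq
    rintro q (⟨j, ⟨hj1, hj2⟩, rfl⟩ | rfl)
    · rw [SetLike.mem_coe, RingHom.mem_ker, AlgHom.comp_apply]
      dsimp only
      rw [aeval_sq, Ideal.Quotient.mkₐ_eq_mk, Ideal.Quotient.eq_zero_iff_mem,
        Ideal.mem_span_singleton]
      have h1 := prod_coeff x j hj2
      rw [← hx] at h1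
      have h2 : p ∣ (-1) ^ j * MvPolynomial.aeval (fun i => x i ^ 2)
          (MvPolynomial.esymm (Fin n) ℝ j) := by
        rw [← h1]
        simp only [Polynomial.map_sub, Polynomial.map_pow, Polynomial.map_X, Polynomial.map_C,
          Polynomial.coeff_sub, Polynomial.coeff_X_pow, Polynomial.coeff_C]
        rw [if_neg (by omega)]
        apply dvd_sub (dvd_zero _)
        split_ifs
        · rw [hX]; exact (dvd_pow_self p two_ne_zero).mul_left _
        · exact dvd_zero _
      exact ((IsUnit.pow j isUnit_one.neg).dvd_mul_left).mp h2
    · rw [SetLike.mem_coe, RingHom.mem_ker, AlgHom.comp_apply, map_prod]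
      simp only [MvPolynomial.aeval_X]
      rw [← hp, Ideal.Quotient.mkₐ_eq_mk, Ideal.Quotient.eq_zero_iff_mem,
        Ideal.mem_span_singleton]
  let Φ : (MvPolynomial (Fin n) ℝ ⧸ sqSymIdealD n) →ₐ[ℝ] (E ⧸ Ideal.span {p}) :=
    Ideal.Quotient.liftₐ _ _ hK
  let Q := MvPolynomial (Fin n) ℝ ⧸ sqSymIdealD n
  let h : ℝ[X] →+* Q := (Polynomial.aeval (0 : Q)).toRingHom
  let y : Fin n → Q := fun i => Ideal.Quotient.mk _ (MvPolynomial.X i)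
  have hy : (Polynomial.X ^ n - Polynomial.C Polynomial.X : ℝ[X][X]).map h =
      ∏ i, (Polynomial.X - Polynomial.C (y i ^ 2)) := by
    have h0 : h Polynomial.X = 0 := by simp [h]
    rw [Polynomial.map_sub, Polynomial.map_pow, Polynomial.map_X, Polynomial.map_C, h0,
      map_zero, sub_zero]
    ext k
    by_cases hk : k ≤ n
    · obtain ⟨j, hj, rfl⟩ : ∃ j, j ≤ n ∧ k = n - j := ⟨n - k, by omega, by omega⟩
      rw [prod_coeff y j hj, Polynomial.coeff_X_pow]
      rcases Nat.eq_zero_or_pos j with rfl | hj0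
      · simp
      · rw [if_neg (by omega), ← aeval_sq]
        have hyy : MvPolynomial.aeval y = Ideal.Quotient.mkₐ ℝ (sqSymIdealD n) := by
          ext i; simp only [MvPolynomial.aeval_X]; rfl
        rw [hyy, Ideal.Quotient.mkₐ_eq_mk, Ideal.Quotient.eq_zero_iff_mem.mpr, mul_zero]
        exact Ideal.subset_span (Or.inl ⟨j, ⟨hj0, hj⟩, rfl⟩)
    · rw [Polynomial.coeff_X_pow, if_neg (by omega), Polynomial.coeff_eq_zero_of_natDegree_lt]
      refine lt_of_le_of_lt (Polynomial.natDegree_prod_le _ _) ?_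
      refine lt_of_le_of_lt (Finset.sum_le_sum (fun i _ => Polynomial.natDegree_X_sub_C_le _)) ?_
      simp; omega
  obtain ⟨φ, hφ, hφx⟩ := hex Q h y hy
  have hφp : ∀ a ∈ Ideal.span {p}, φ a = 0 := by
    intro a ha
    obtain ⟨c, rfl⟩ := Ideal.mem_span_singleton.mp ha
    rw [map_mul, hp, map_prod]
    simp only [hφx, y]
    rw [← map_prod, Ideal.Quotient.eq_zero_iff_mem.mpr, zero_mul]
    exact Ideal.subset_span (Or.inr rfl)
  let Ψ : (E ⧸ Ideal.span {p}) →+* Q := Ideal.Quotient.lift _ φ hφp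
  have hφr : ∀ r : ℝ, φ (algebraMap ℝ E r) = algebraMap ℝ Q r := by
    intro r
    have := RingHom.congr_fun hφ (algebraMap ℝ ℝ[X] r)
    rw [RingHom.comp_apply] at this
    refine this.trans ?_
    simp [h]
  have hΦy : ∀ i, Φ (y i) = Ideal.Quotient.mk _ (x i) := by
    intro i
    change Ideal.Quotient.mk _ (MvPolynomial.aeval x (MvPolynomial.X i)) = _
    rw [MvPolynomial.aeval_X]
  have h1 : ∀ q, Ψ (Φ q) = q := by
    intro q
    have : (Ψ.comp (Φ : Q →+* _)).comp (Ideal.Quotient.mk _) =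
        (RingHom.id Q).comp (Ideal.Quotient.mk _) := by
      apply MvPolynomial.ringHom_ext
      · intro r
        have e1 : (Ideal.Quotient.mk (sqSymIdealD n)) (MvPolynomial.C r) = algebraMap ℝ Q r := rfl
        simp only [RingHom.comp_apply, RingHom.id_apply]
        rw [e1]
        change Ψ (Φ (algebraMap ℝ Q r)) = _
        rw [AlgHom.commutes]
        exact hφr r
      · intro i
        change Ψ (Φ (y i)) = y i
        rw [hΦy]
        exact hφx i
    exact RingHom.congr_fun (Ideal.Quotient.ringHom_ext this) q
  have h2 : ∀ q, Φ (Ψ q) = q := by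
    have : (Φ : Q →+* _).comp φ = Ideal.Quotient.mk (Ideal.span {p}) := by
      apply hun
      · rw [RingHom.comp_assoc, hφ]
        apply Polynomial.ringHom_ext
        · intro r
          have : h (Polynomial.C r) = algebraMap ℝ Q r := by simp [h]
          change Φ (h (Polynomial.C r)) = _
          rw [this, AlgHom.commutes]; rfl
        · have h0 : h Polynomial.X = 0 := by simp [h]
          change Φ (h Polynomial.X) = Ideal.Quotient.mk _ (algebraMap ℝ[X] E Polynomial.X)
          rw [h0, map_zero, hX, eq_comm, Ideal.Quotient.eq_zero_iff_mem,
            Ideal.mem_span_singleton]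
          exact (dvd_pow_self p two_ne_zero).mul_left _
      · intro i
        change Φ (φ (x i)) = _
        rw [hφx, hΦy]
    intro q
    obtain ⟨a, rfl⟩ := Ideal.Quotient.mk_surjective q
    exact RingHom.congr_fun this a
  let e : Q ≃ₗ[ℝ] (E ⧸ Ideal.span {p}) :=
    LinearEquiv.ofBijective Φ.toLinearMap
      ⟨Function.LeftInverse.injective h1, Function.RightInverse.surjective h2⟩
  refine ⟨Module.Finite.equiv e.symm, ?_⟩
  have := e.finrank_eq
  change 2 * Module.finrank ℝ Q = _
  rw [this, hdim]

end SpinQ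

/-- The quotient `ℝ[x₁,…,xₙ]/K` is a finite-dimensional real vector space of
dimension `2^{n-1} · n!`. -/
theorem finrank_spin_quotient (n : ℕ) (hn : 2 ≤ n) :
    Module.Finite ℝ (MvPolynomial (Fin n) ℝ ⧸ sqSymIdealD n) ∧
    Module.finrank ℝ (MvPolynomial (Fin n) ℝ ⧸ sqSymIdealD n) =
      2 ^ (n - 1) * Nat.factorial n := by
  obtain ⟨h1, h2⟩ := SpinQ.main n (by omega)
  refine ⟨h1, ?_⟩
  obtain ⟨m, rfl⟩ : ∃ m, n = m + 1 := ⟨n - 1, by omega⟩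
  rw [pow_succ, mul_comm _ 2, mul_assoc] at h2
  simpa using h2
end

section
/- For every n ≥ 2, the monomial x₂² x₃⁴ x₄⁶ ⋯ xₙ^{2n−2} (that is, ∏_{i=2}^{n} x_i^{2i−2}) does not belong to the ideal K; equivalently, its image in the quotient ℝ[x₁,…,xₙ]/K is nonzero. -/
open MvPolynomial

noncomputable def altA {n : ℕ} (h : MvPolynomial (Fin n) ℝ) : MvPolynomial (Fin n) ℝ :=
  ∑ σ : Equiv.Perm (Fin n), ((Equiv.Perm.sign σ : ℤ) : ℝ) • rename σ h

noncomputable def dlt (n : ℕ) : Fin n →₀ ℕ := Finsupp.equivFunOnFinite.symm (fun i => 2 * i.val)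

lemma dlt_apply (n : ℕ) (i : Fin n) : dlt n i = 2 * i.val := rfl

lemma altA_add {n : ℕ} (f g : MvPolynomial (Fin n) ℝ) : altA (f + g) = altA f + altA g := by
  simp [altA, Finset.sum_add_distrib]

lemma altA_mul {n : ℕ} (e h : MvPolynomial (Fin n) ℝ)
    (he : ∀ σ : Equiv.Perm (Fin n), rename σ e = e) : altA (e * h) = e * altA h := by
  simp [altA, he, Finset.mul_sum]

lemma rename_altA {n : ℕ} (τ : Equiv.Perm (Fin n)) (h : MvPolynomial (Fin n) ℝ) :
    rename τ (altA h) = ((Equiv.Perm.sign τ : ℤ) : ℝ) • altA h := by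
  unfold altA
  rw [map_sum, Finset.smul_sum]
  refine Fintype.sum_equiv (Equiv.mulLeft τ) _ _ (fun σ => ?_)
  rw [map_smul, rename_rename, smul_smul]
  congr 1
  rcases Int.units_eq_one_or (Equiv.Perm.sign τ) with h | h <;> simp [h]

lemma coeff_altA {n : ℕ} (h : MvPolynomial (Fin n) ℝ) (d : Fin n →₀ ℕ) (p q : Fin n)
    (hpq : p ≠ q) (hd : d p = d q) : coeff d (altA h) = 0 := by
  have h1 := coeff_rename_mapDomain (Equiv.swap p q) (Equiv.swap p q).injective (altA h) d
  have h2 : d.mapDomain (Equiv.swap p q) = d := by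
    ext i
    rw [← Finsupp.equivMapDomain_eq_mapDomain, Finsupp.equivMapDomain_apply, Equiv.symm_swap]
    rcases eq_or_ne i p with rfl | hp
    · simp [hd]
    rcases eq_or_ne i q with rfl | hq
    · simp [hd]
    rw [Equiv.swap_apply_of_ne_of_ne hp hq]
  rw [h2, rename_altA, Equiv.Perm.sign_swap hpq] at h1
  simp at h1
  linarith

lemma prod_X_pow {n : ℕ} (s : Finset (Fin n)) (k : ℕ) :
    ∏ i ∈ s, (X i : MvPolynomial (Fin n) ℝ) ^ k =
      monomial (∑ i ∈ s, Finsupp.single i k) 1 := by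
  simp only [X_pow_eq_monomial]
  rw [monomial_sum_one]

lemma sum_single_apply' {n : ℕ} (s : Finset (Fin n)) (k : ℕ) (j : Fin n) :
    (∑ i ∈ s, Finsupp.single i k : Fin n →₀ ℕ) j = if j ∈ s then k else 0 := by
  simp [Finsupp.finsetSum_apply, Finsupp.single_apply]

lemma coeff_sq {n : ℕ} (s : Finset (Fin n)) (hs : s.Nonempty) (h : MvPolynomial (Fin n) ℝ) :
    coeff (dlt n) ((∏ i ∈ s, (X i : MvPolynomial (Fin n) ℝ) ^ 2) * altA h) = 0 := by
  rw [prod_X_pow, coeff_monomial_mul']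
  split_ifs with hle
  · rw [one_mul]
    have hp := s.min'_mem hs
    have hmin : ∀ q ∈ s, s.min' hs ≤ q := fun q hq => s.min'_le q hq
    generalize s.min' hs = p at hp hmin
    have h0 := hle p
    rw [sum_single_apply', if_pos hp, dlt_apply] at h0
    have hq : (⟨p.val - 1, by omega⟩ : Fin n) ∉ s := fun hq => by
      have := hmin _ hq
      rw [Fin.le_def] at this
      simp at this
      omega
    apply coeff_altA h _ p ⟨p.val - 1, by omega⟩
    · intro h
      have := congrArg Fin.val h
      simp at this
      omega
    · rw [Finsupp.tsub_apply, Finsupp.tsub_apply, sum_single_apply', sum_single_apply',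
        if_pos hp, if_neg hq, dlt_apply, dlt_apply]
      simp only
      omega
  · rfl

lemma coeff_altA_top (n : ℕ) : coeff (dlt n) (altA (monomial (dlt n) (1:ℝ))) = 1 := by
  unfold altA
  rw [coeff_sum, Finset.sum_eq_single 1]
  · simp
  · intro σ _ hσ
    rw [coeff_smul, rename_monomial, coeff_monomial, if_neg, smul_zero]
    intro h
    apply hσ
    ext i
    have := DFunLike.congr_fun h (σ i)
    rw [Finsupp.mapDomain_apply σ.injective, dlt_apply, dlt_apply] at this
    simp
    omega
  · simp

/-- The monomial `x₂² x₃⁴ ⋯ xₙ^{2n-2}` does not belong to the ideal `K`; here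
`x_i` is the variable of index `i - 1` in `Fin n`, so the variable of index
`i : Fin n` carries exponent `2 (i.val + 1) - 2 = 2 i.val`. -/
theorem top_monomial_not_in_ideal_spin (n : ℕ) (hn : 2 ≤ n) :
    (∏ i : Fin n, (X i : MvPolynomial (Fin n) ℝ) ^ (2 * i.val)) ∉
      sqSymIdealD n := by
  intro hmem
  have key : ∀ f ∈ sqSymIdealD n, ∀ h, coeff (dlt n) (altA (f * h)) = 0 := by
    intro f hf
    unfold sqSymIdealD at hf
    induction hf using Submodule.span_induction with
    | mem x hx =>
      intro h
      rcases hx with ⟨j, hj, rfl⟩ | hx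
      · rw [altA_mul]
        · have : (aeval (fun i => (X i : MvPolynomial (Fin n) ℝ) ^ 2)
              (MvPolynomial.esymm (Fin n) ℝ j)) =
              ∑ s ∈ Finset.powersetCard j Finset.univ, ∏ i ∈ s,
                (X i : MvPolynomial (Fin n) ℝ) ^ 2 := by
            simp [esymm]
          simp only [this]
          rw [Finset.sum_mul, coeff_sum]
          refine Finset.sum_eq_zero (fun s hs => coeff_sq s ?_ h)
          rw [← Finset.card_pos, (Finset.mem_powersetCard.1 hs).2]
          exact hj.1
        · intro σ
          have h1 := esymm_isSymmetric (Fin n) ℝ j σ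
          beta_reduce
          conv_rhs => rw [← h1]
          rw [aeval_rename, ← AlgHom.comp_apply, comp_aeval]
          simp [Function.comp_def]
      · rw [Set.mem_singleton_iff] at hx
        subst hx
        rw [altA_mul]
        · have := prod_X_pow (Finset.univ : Finset (Fin n)) 1
          simp only [pow_one] at this
          rw [this, coeff_monomial_mul', if_neg]
          intro hle
          have h0 := hle ⟨0, by omega⟩
          rw [sum_single_apply', dlt_apply] at h0
          simp at h0
        · intro σ
          simp only [map_prod, rename_X]
          exact Equiv.prod_comp σ (fun i => (X i : MvPolynomial (Fin n) ℝ))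
    | zero => intro h; simp [altA]
    | add x y _ _ hx hy => intro h; rw [add_mul, altA_add, coeff_add, hx, hy, add_zero]
    | smul a x _ hx =>
      intro h
      rw [smul_eq_mul, mul_comm a x, mul_assoc]
      exact hx _
  have h1 := key _ hmem 1
  have h2 : (∏ i : Fin n, (X i : MvPolynomial (Fin n) ℝ) ^ (2 * i.val)) =
      monomial (dlt n) 1 := by
    simp only [X_pow_eq_monomial]
    rw [← monomial_sum_one]
    congr 2
    ext j
    simp [Finsupp.finsetSum_apply, Finsupp.single_apply, dlt_apply]
  rw [mul_one, h2, coeff_altA_top] at h1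
  exact one_ne_zero h1
end
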